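/- arXiv:0904.2068 — 4 statements merged into one kernel-verified Lean document; each statement's English description precedes it below -/
import Mathlib

section
/- Let I ⊆ ℝ be an interval and let c : I → ℂ^n be a continuous curve with c(t) ∈ σ(ℂ^m) for all t ∈ I. Then there exists a continuous lift of c, i.e., a continuous curve c̄ : I → ℂ^m with σ(c̄(t)) = c(t) for all t ∈ I. -/
open MeasureTheory Set Filter

open Topology

section Selection

variable {ι X : Type*} [LinearOrder ι] [MetricSpace X]

/-- Along the finite set `T`, each value of `x` is a point of `F` nearest to the previous value. -/
def IsGreedySelection (F : ι → Set X) (T : Finset ι) (x : ι → X) : Prop :=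
  ∀ u ∈ T, ∀ v ∈ T, u < v → (∀ w ∈ T, ¬(u < w ∧ w < v)) →
    ∀ y ∈ F v, dist (x u) (x v) ≤ dist (x u) y

theorem exists_isGreedySelection (F : ι → Set X) (hfin : ∀ t, (F t).Finite)
    (hne : ∀ t, (F t).Nonempty) (T : Finset ι) :
    ∃ x : ι → X, (∀ t, x t ∈ F t) ∧ IsGreedySelection F T x := by
  induction T using Finset.induction_on_max with
  | empty =>
    choose x hx using hne
    exact ⟨x, hx, by simp [IsGreedySelection]⟩
  | insert a T ha ih =>
    obtain ⟨x, hx, hg⟩ := ih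
    rcases T.eq_empty_or_nonempty with rfl | hT
    · refine ⟨x, hx, ?_⟩
      intro u hu v hv huv
      simp at hu hv
      exact absurd huv (by simp [hu, hv])
    obtain ⟨z, hz, hmin⟩ :=
      (F a).exists_min_image (fun y => dist (x (T.max' hT)) y) (hfin a) (hne a)
    refine ⟨Function.update x a z, ?_, ?_⟩
    · intro t
      by_cases h : t = a
      · subst h; simpa using hz
      · simpa [Function.update_of_ne h] using hx t
    · intro u hu v hv huv hcons y hy
      have hua : u ≠ a := by
        rintro rfl
        rcases Finset.mem_insert.1 hv with rfl | hv
        · exact lt_irrefl _ huv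
        · exact lt_asymm huv (ha v hv)
      have huT : u ∈ T := (Finset.mem_insert.1 hu).resolve_left hua
      rw [Function.update_of_ne hua]
      by_cases hva : v = a
      · subst hva
        have hum : u = T.max' hT := by
          refine le_antisymm (T.le_max' u huT) (not_lt.1 fun h => ?_)
          exact hcons _ (Finset.mem_insert_of_mem (T.max'_mem hT)) ⟨h, ha _ (T.max'_mem hT)⟩
        rw [Function.update_self, hum]
        exact hmin y hy
      · rw [Function.update_of_ne hva]
        exact hg u huT v ((Finset.mem_insert.1 hv).resolve_left hva) huv
          (fun w hw => hcons w (Finset.mem_insert_of_mem hw)) y hy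

/-- A greedy selection does not leave the ball around its value at `s` as long as `F` stays
within `r` of `F s`, where `4 * r` is at most the separation of the points of `F s`. -/
theorem IsGreedySelection.dist_lt {F : ι → Set X} {T : Finset ι} {x : ι → X}
    (hg : IsGreedySelection F T x) (hx : ∀ t, x t ∈ F t) {J : Set ι} (hJ : J.OrdConnected)
    {s : ι} (hsT : s ∈ T) (hsJ : s ∈ J) {r : ℝ} (hr : 0 < r)
    (hsep : ∀ p ∈ F s, ∀ q ∈ F s, dist p q < 4 * r → p = q)
    (hF : ∀ u ∈ J, (∀ y ∈ F u, ∃ p ∈ F s, dist y p < r) ∧ ∀ p ∈ F s, ∃ y ∈ F u, dist y p < r)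
    {t : ι} (htT : t ∈ T) (htJ : t ∈ J) : dist (x t) (x s) < r := by
  have jump : ∀ u ∈ T, ∀ v ∈ T, u ∈ J → v ∈ J → u < v → (∀ w ∈ T, ¬(u < w ∧ w < v)) →
      dist (x u) (x v) < 2 * r := by
    intro u hu v hv huJ hvJ huv hc
    obtain ⟨p, hp, hup⟩ := (hF u huJ).1 _ (hx u)
    obtain ⟨y, hy, hyp⟩ := (hF v hvJ).2 p hp
    have h1 := hg u hu v hv huv hc y hy
    have h2 := dist_triangle_right (x u) y p
    linarith
  have step : ∀ u v, v ∈ J → dist (x u) (x v) < 2 * r → dist (x u) (x s) < r →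
      dist (x v) (x s) < r := by
    intro u v hv huv hu
    obtain ⟨q, hq, hvq⟩ := (hF v hv).1 _ (hx v)
    have h1 : dist q (x s) ≤ dist (x v) q + dist (x u) (x v) + dist (x u) (x s) := by
      have h2 := dist_triangle_left q (x s) (x v)
      have h3 := dist_triangle_left (x v) (x s) (x u)
      linarith
    have := hsep q hq (x s) (hx s) (by linarith)
    rwa [← this]
  classical
  by_contra hbad
  have hts : t ≠ s := by rintro rfl; exact hbad (by simpa using hr)
  rcases lt_or_gt_of_ne hts with hlt | hlt
  · obtain ⟨v, hv, hmax⟩ :=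
      (T.filter fun w => w ∈ J ∧ w < s ∧ ¬ dist (x w) (x s) < r).exists_max_image id
        ⟨t, by simpa [htT, htJ, hlt] using hbad⟩
    simp only [Finset.mem_filter, id] at hv hmax
    obtain ⟨hvT, hvJ, hvs, hvb⟩ := hv
    obtain ⟨u, hu, humin⟩ := (T.filter fun w => v < w).exists_min_image id ⟨s, by simp [*]⟩
    simp only [Finset.mem_filter, id] at hu humin
    have hus : u ≤ s := humin s ⟨hsT, hvs⟩
    have huJ : u ∈ J := hJ.out hvJ hsJ ⟨hu.2.le, hus⟩
    have hud : dist (x u) (x s) < r := by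
      rcases hus.eq_or_lt with rfl | hus
      · simpa using hr
      · by_contra h
        exact (hmax u ⟨hu.1, huJ, hus, h⟩).not_gt hu.2
    refine hvb (step u v hvJ ?_ hud)
    rw [dist_comm]
    exact jump v hvT u hu.1 hvJ huJ hu.2 fun w hw h => (humin w ⟨hw, h.1⟩).not_gt h.2
  · obtain ⟨v, hv, hmin⟩ :=
      (T.filter fun w => w ∈ J ∧ s < w ∧ ¬ dist (x w) (x s) < r).exists_min_image id
        ⟨t, by simpa [htT, htJ, hlt] using hbad⟩
    simp only [Finset.mem_filter, id] at hv hmin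
    obtain ⟨hvT, hvJ, hvs, hvb⟩ := hv
    obtain ⟨u, hu, humax⟩ := (T.filter fun w => w < v).exists_max_image id ⟨s, by simp [*]⟩
    simp only [Finset.mem_filter, id] at hu humax
    have hus : s ≤ u := humax s ⟨hsT, hvs⟩
    have huJ : u ∈ J := hJ.out hsJ hvJ ⟨hus, hu.2.le⟩
    have hud : dist (x u) (x s) < r := by
      rcases hus.eq_or_lt with rfl | hus
      · simpa using hr
      · by_contra h
        exact (hmin u ⟨hu.1, huJ, hus, h⟩).not_gt hu.2
    exact hvb (step u v hvJ
      (jump u hu.1 v hvT huJ hvJ hu.2 fun w hw h => (humax w ⟨hw, h.2⟩).not_gt h.1) hud)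

/-- A finite-valued map on a linear order that is continuous for the Hausdorff distance has a
continuous selection. -/
theorem exists_continuous_selection [TopologicalSpace ι] [OrderTopology ι] (F : ι → Set X)
    (hfin : ∀ t, (F t).Finite) (hne : ∀ t, (F t).Nonempty)
    (hF : ∀ s, ∀ ε > 0, ∀ᶠ u in 𝓝 s,
      (∀ y ∈ F u, ∃ p ∈ F s, dist y p < ε) ∧ ∀ p ∈ F s, ∃ y ∈ F u, dist y p < ε) :
    ∃ χ : ι → X, Continuous χ ∧ ∀ t, χ t ∈ F t := by
  choose x hx hg using exists_isGreedySelection F hfin hne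
  have (t : ι) : Finite (F t) := hfin t
  obtain ⟨χ, hχ⟩ := Finset.rado_selection (β := fun t => F t) fun T t => ⟨x T t, hx T t⟩
  refine ⟨fun t => χ t, continuous_iff_continuousAt.2 fun s => ?_, fun t => (χ t).2⟩
  rw [ContinuousAt, Metric.tendsto_nhds]
  intro ε hε
  obtain ⟨δ, hδ, hsep⟩ : ∃ δ > 0, ∀ p ∈ F s, ∀ q ∈ F s, dist p q < δ → p = q := by
    have h : 0 < (F s).infsep ∨ (F s).Subsingleton := by
      rw [or_iff_not_imp_right, Set.not_subsingleton_iff]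
      exact fun h => ((hfin s).infsep_pos_iff_nontrivial).2 h
    rcases h with h | h
    · refine ⟨_, h, fun p hp q hq hpq => ?_⟩
      by_contra hne
      exact hpq.not_ge (infsep_le_dist_of_mem hp hq hne)
    · exact ⟨1, one_pos, fun p hp q hq _ => h hp hq⟩
  have hr : 0 < min ε (δ / 4) := by positivity
  filter_upwards [(tendsto_const_nhds.uIcc tendsto_id).eventually
    (Filter.Eventually.smallSets (hF s _ hr))] with t ht
  obtain ⟨T, hT, hχT⟩ := hχ {s, t}
  rw [hχT s (by simp), hχT t (by simp)]
  exact ((hg T).dist_lt (hx T) (J := uIcc s t) ordConnected_uIcc (hT (by simp)) left_mem_uIcc hr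
    (fun p hp q hq hpq => hsep p hp q hq (by linarith [min_le_right ε (δ / 4)])) ht
    (hT (by simp)) right_mem_uIcc).trans_le (min_le_left _ _)

end Selection

section Invariants

variable {m n : ℕ} {G : Type*} [Group G] [Fintype G]

open MvPolynomial

/-- The pullback of a polynomial along a linear map. -/
theorem exists_eval_comp_linearMap (L : (Fin m → ℂ) →ₗ[ℂ] (Fin m → ℂ))
    (q : MvPolynomial (Fin m) ℂ) :
    ∃ p : MvPolynomial (Fin m) ℂ, ∀ x, eval x p = eval (L x) q := by
  refine ⟨bind₁ (fun i => ∑ j, C (L (Pi.single j 1) i) * X j) q, fun x => ?_⟩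
  rw [← coe_aeval_eq_eval, ← coe_aeval_eq_eval]
  simp only [RingHom.coe_coe, aeval_bind₁]
  congr 2
  ext i
  conv_rhs => rw [← LinearMap.toMatrix'_mulVec L x]
  simp [Matrix.mulVec, dotProduct, LinearMap.toMatrix'_apply]

theorem exists_eval_eq_zero_eval_eq_one {S : Set (Fin m → ℂ)} (hS : S.Finite) {x : Fin m → ℂ}
    (hx : x ∉ S) :
    ∃ q : MvPolynomial (Fin m) ℂ, eval x q = 0 ∧ ∀ b ∈ S, eval b q = 1 := by
  have h : ∀ b : Fin m → ℂ, ∃ q : MvPolynomial (Fin m) ℂ,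
      eval b q = 0 ∧ (b ∈ S → eval x q ≠ 0) := by
    intro b
    by_cases hb : b ∈ S
    · have : x ≠ b := fun h => hx (h ▸ hb)
      obtain ⟨i, hi⟩ := Function.ne_iff.1 this
      exact ⟨X i - C (b i), by simp, fun _ => by simpa [sub_eq_zero] using hi⟩
    · exact ⟨0, by simp, fun h => absurd h hb⟩
  choose q hq0 hq1 using h
  let P := ∏ b ∈ hS.toFinset, q b
  have hP : eval x P ≠ 0 := by
    simp only [P, map_prod]
    exact Finset.prod_ne_zero_iff.2 fun b hb => hq1 b (by simpa using hb)
  refine ⟨1 - C (eval x P)⁻¹ * P, by simp [hP], fun b hb => ?_⟩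
  have : eval b P = 0 := by
    simp only [P, map_prod]
    exact Finset.prod_eq_zero (hS.mem_toFinset.2 hb) (hq0 b)
  simp [this]

/-- Generators of the invariant algebra of a finite group separate orbits. -/
theorem exists_eq_apply_of_eval_eq (ρ : G →* ((Fin m → ℂ) ≃ₗ[ℂ] (Fin m → ℂ)))
    (σ : Fin n → MvPolynomial (Fin m) ℂ)
    (hgen : ∀ f : MvPolynomial (Fin m) ℂ,
      (∀ g x, eval (ρ g x) f = eval x f) → ∃ p : MvPolynomial (Fin n) ℂ, aeval σ p = f)
    {x y : Fin m → ℂ} (hxy : ∀ k, eval x (σ k) = eval y (σ k)) : ∃ g, x = ρ g y := by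
  by_contra hcon
  obtain ⟨q, hqx, hqy⟩ := exists_eval_eq_zero_eval_eq_one (S := Set.range fun g => ρ g y)
    (Set.finite_range _) (x := x) (by rintro ⟨g, hg⟩; exact hcon ⟨g, hg.symm⟩)
  choose P hP using fun g => exists_eval_comp_linearMap (ρ g : (Fin m → ℂ) →ₗ[ℂ] (Fin m → ℂ)) q
  obtain ⟨p, hp⟩ := hgen (∏ g, P g) fun g z => by
    simp only [map_prod, hP]
    exact Fintype.prod_equiv (Equiv.mulRight g) _ _ fun h => by simp
  have key : eval x (∏ g, P g) = eval y (∏ g, P g) := by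
    have h (z : Fin m → ℂ) : eval z (aeval σ p) = eval (fun k => eval z (σ k)) p := by
      rw [← coe_aeval_eq_eval, ← coe_aeval_eq_eval]
      simp only [RingHom.coe_coe]
      rw [← bind₁, aeval_bind₁]
    rw [← hp, h, h]
    simp only [hxy]
  rw [map_prod, map_prod, Finset.prod_eq_zero (Finset.mem_univ 1) (by simp [hP, hqx])] at key
  refine zero_ne_one (key.trans (Finset.prod_eq_one fun g _ => ?_))
  rw [hP]
  exact hqy _ ⟨g, rfl⟩

theorem MvPolynomial.IsHomogeneous.eval_smul {p : MvPolynomial (Fin m) ℂ} {d : ℕ}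
    (hp : p.IsHomogeneous d) (a : ℂ) (x : Fin m → ℂ) : eval (a • x) p = a ^ d * eval x p := by
  rw [eval_eq', eval_eq', Finset.mul_sum]
  refine Finset.sum_congr rfl fun e he => ?_
  have h : ∑ i, e i = d := by
    rw [← hp (mem_support_iff.1 he), Finsupp.weight_apply, Finsupp.sum_fintype _ _ (by simp)]
    simp
  simp only [Pi.smul_apply, smul_eq_mul, mul_pow, Finset.prod_mul_distrib,
    Finset.prod_pow_eq_pow_sum, h]
  ring

/-- Homogeneous polynomials of positive degree without a nontrivial common zero define a proper
map. -/
theorem isProperMap_of_isHomogeneous (σ : Fin n → MvPolynomial (Fin m) ℂ) (deg : Fin n → ℕ)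
    (hdeg : ∀ k, 1 ≤ deg k) (hhom : ∀ k, (σ k).IsHomogeneous (deg k))
    (hzero : ∀ x, (∀ k, eval x (σ k) = 0) → x = 0) :
    IsProperMap fun x k => eval x (σ k) := by
  have hcont : Continuous fun x k => eval x (σ k) :=
    continuous_pi fun k => MvPolynomial.continuous_eval _
  rw [isProperMap_iff_tendsto_cocompact]
  refine ⟨hcont, ?_⟩
  obtain ⟨μ, hμ, hle⟩ : ∃ μ > 0, ∀ u : Fin m → ℂ, ‖u‖ = 1 → μ ≤ ‖fun k => eval u (σ k)‖ := by
    rcases (Metric.sphere (0 : Fin m → ℂ) 1).eq_empty_or_nonempty with h | h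
    · refine ⟨1, one_pos, fun u hu => ?_⟩
      have : u ∈ Metric.sphere (0 : Fin m → ℂ) 1 := by simpa using hu
      simp [h] at this
    · obtain ⟨u, hu, hmin⟩ := (isCompact_sphere (0 : Fin m → ℂ) 1).exists_isMinOn h
        hcont.norm.continuousOn
      refine ⟨_, norm_pos_iff.2 fun h0 => ?_, fun v hv => hmin (by simpa using hv)⟩
      have := hzero u fun k => congrFun h0 k
      simp [this] at hu
  have hgrow (x : Fin m → ℂ) (hx : 1 ≤ ‖x‖) : μ * ‖x‖ ≤ ‖fun k => eval x (σ k)‖ := by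
    have hx0 : (‖x‖ : ℂ) ≠ 0 := by
      simpa using (norm_pos_iff.1 (by linarith : 0 < ‖x‖))
    have hu := hle ((‖x‖ : ℂ)⁻¹ • x) (by
      rw [norm_smul, norm_inv, Complex.norm_real, norm_norm, inv_mul_cancel₀ (by positivity)])
    have hsc : ‖fun k => eval ((‖x‖ : ℂ)⁻¹ • x) (σ k)‖ ≤ ‖x‖⁻¹ * ‖fun k => eval x (σ k)‖ := by
      refine (pi_norm_le_iff_of_nonneg (by positivity)).2 fun k => ?_
      rw [(hhom k).eval_smul, norm_mul, norm_pow, norm_inv, Complex.norm_real, norm_norm]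
      gcongr
      · exact pow_le_of_le_one (by positivity) (inv_le_one_of_one_le₀ hx) (by have := hdeg k; omega)
      · exact norm_le_pi_norm (fun k => eval x (σ k)) k
    have := hu.trans hsc
    rwa [inv_mul_eq_div, le_div_iff₀ (by linarith)] at this
  rw [← Metric.cobounded_eq_cocompact, ← Metric.cobounded_eq_cocompact,
    ← tendsto_norm_atTop_iff_cobounded]
  refine tendsto_atTop_mono' _ ?_ (tendsto_norm_cobounded_atTop.const_mul_atTop hμ)
  filter_upwards [tendsto_norm_cobounded_atTop.eventually_ge_atTop 1] with x hx
  exact hgrow x hx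

end Invariants


/-- Continuous curves in the quotient `σ(ℂ^m)` of a finite group representation
admit continuous lifts. -/
theorem stmt1
    {m n : ℕ} {G : Type} [Group G] [Fintype G]
    (ρ : G →* ((Fin m → ℂ) ≃ₗ[ℂ] (Fin m → ℂ)))
    (σ : Fin n → MvPolynomial (Fin m) ℂ) (deg : Fin n → ℕ)
    (hdeg : ∀ k, 1 ≤ deg k)
    (hhom : ∀ k, (σ k).IsHomogeneous (deg k))
    (hinv : ∀ k g x, MvPolynomial.eval (ρ g x) (σ k) = MvPolynomial.eval x (σ k))
    (hgen : ∀ f : MvPolynomial (Fin m) ℂ,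
      (∀ g x, MvPolynomial.eval (ρ g x) f = MvPolynomial.eval x f) →
      ∃ p : MvPolynomial (Fin n) ℂ, MvPolynomial.aeval σ p = f)
    (σm : (Fin m → ℂ) → (Fin n → ℂ))
    (hσm : ∀ x k, σm x k = MvPolynomial.eval x (σ k))
    (I : Set ℝ) (hI : I.OrdConnected)
    (c : ℝ → Fin n → ℂ) (hc : ContinuousOn c I)
    (hcσ : ∀ t ∈ I, ∃ x : Fin m → ℂ, σm x = c t) :
    ∃ cb : ℝ → Fin m → ℂ, ContinuousOn cb I ∧ ∀ t ∈ I, σm (cb t) = c t := by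
  obtain rfl : σm = fun x k => MvPolynomial.eval x (σ k) := by
    ext x k
    exact hσm x k
  have horbit {x y : Fin m → ℂ} (h : (fun k => MvPolynomial.eval x (σ k)) =
      fun k => MvPolynomial.eval y (σ k)) : ∃ g, x = ρ g y :=
    exists_eq_apply_of_eval_eq ρ σ hgen fun k => congrFun h k
  have hproper := isProperMap_of_isHomogeneous σ deg hdeg hhom fun x hx => by
    obtain ⟨g, hg⟩ := horbit (x := x) (y := 0) (by
      ext k
      have h0 := (hhom k).eval_smul 0 0
      rw [smul_zero, zero_pow (by have := hdeg k; omega), zero_mul] at h0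
      rw [hx k, h0])
    simpa using hg
  let F : I → Set (Fin m → ℂ) := fun t => {x | (fun k => MvPolynomial.eval x (σ k)) = c t}
  have hne (t : I) : (F t).Nonempty := hcσ t t.2
  have hfin (t : I) : (F t).Finite := by
    obtain ⟨y, hy⟩ := hne t
    refine (Set.finite_range fun g => ρ g y).subset fun x hx => ?_
    obtain ⟨g, hg⟩ := horbit (hx.trans hy.symm)
    exact ⟨g, hg.symm⟩
  have hnear (s : I) (ε : ℝ) (hε : 0 < ε) : ∀ᶠ u in 𝓝 s, ∀ y ∈ F u, ∃ p ∈ F s,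
      ∀ g, dist (ρ g y) (ρ g p) < ε := by
    refine (hc.domRestrict.tendsto s).eventually (hproper.isClosedMap.eventually_nhds_fiber
      (p := fun y => ∃ p ∈ F s, ∀ g, dist (ρ g y) (ρ g p) < ε) _ fun p hp => ?_)
    have h : ∀ᶠ y in 𝓝 p, ∀ g, dist (ρ g y) (ρ g p) < ε := eventually_all.2 fun g =>
      Metric.tendsto_nhds.1 ((ρ g).toLinearMap.continuous_of_finiteDimensional.tendsto p) ε hε
    exact h.mono fun y hy => ⟨p, hp, hy⟩
  have := orderTopology_of_ordConnected (t := I)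
  obtain ⟨χ, hχ, hχF⟩ := exists_continuous_selection F hfin hne fun s ε hε => by
    filter_upwards [hnear s ε hε] with u hu
    refine ⟨fun y hy => ?_, fun p hp => ?_⟩
    · obtain ⟨p, hp, h⟩ := hu y hy
      exact ⟨p, hp, by simpa using h 1⟩
    · obtain ⟨y, hy⟩ := hne u
      obtain ⟨q, hq, h⟩ := hu y hy
      obtain ⟨g, rfl⟩ := horbit (hp.trans hq.symm)
      exact ⟨ρ g y, (funext fun k => hinv k g y).trans hy, h g⟩
  classical
  refine ⟨fun t => if h : t ∈ I then χ ⟨t, h⟩ else 0, ?_, fun t ht => ?_⟩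
  · rw [continuousOn_iff_continuous_domRestrict]
    exact hχ.congr fun t => by simp [Set.domRestrict]
  · simp only [dif_pos ht]
    exact hχF ⟨t, ht⟩
end

section
/- Let I ⊆ ℝ be an interval and let c : I → ℂ^n be a continuous curve with c(t) ∈ σ(ℂ^m) for all t ∈ I. If c admits a lift c̃ : I → ℂ^m that is Lipschitz continuous (with respect to the Euclidean norms), then every continuous lift c̄ : I → ℂ^m of c is Lipschitz continuous on I. -/
open MeasureTheory Set Filter

/-- A continuous map on an interval which is covered by finitely many sets, on each of which the
map does not increase distances by more than a factor `K`, satisfies the same bound globally. -/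
theorem dist_le_mul_of_finite_cover {ι X : Type*} [PseudoMetricSpace X] {f : ℝ → X} {K : ℝ}
    (A : ι → Set ℝ) (S : Finset ι) {I : Set ℝ} (hI : I.OrdConnected) (hf : ContinuousOn f I)
    (hA : ∀ i ∈ S, ∀ u ∈ A i ∩ I, ∀ v ∈ A i ∩ I, dist (f u) (f v) ≤ K * dist u v)
    {s t : ℝ} (hs : s ∈ I) (ht : t ∈ I) (hst : s ≤ t)
    (hcov : ∀ u ∈ Icc s t, ∃ i ∈ S, u ∈ A i) :
    dist (f s) (f t) ≤ K * (t - s) := by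
  classical
  induction S using Finset.strongInduction generalizing s with
  | H S ih =>
    obtain ⟨i, hiS, hsi⟩ := hcov s (left_mem_Icc.2 hst)
    have hsub : Icc s t ⊆ I := hI.out hs ht
    set B := A i ∩ Icc s t with hB
    have hsB : s ∈ B := ⟨hsi, left_mem_Icc.2 hst⟩
    have hbdd : BddAbove B := ⟨t, fun u hu => hu.2.2⟩
    set r := sSup B with hr
    have hsr : s ≤ r := le_csSup hbdd hsB
    have hrt : r ≤ t := csSup_le ⟨s, hsB⟩ fun u hu => hu.2.2
    have hrI : r ∈ I := hsub ⟨hsr, hrt⟩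
    have hfr : ContinuousWithinAt f I r := hf r hrI
    have h1 : dist (f s) (f r) ≤ K * (r - s) := by
      have hcl : r ∈ closure B := csSup_mem_closure ⟨s, hsB⟩ hbdd
      have := mem_closure_iff_nhdsWithin_neBot.1 hcl
      have hBI : B ⊆ I := fun u hu => hsub hu.2
      refine le_of_tendsto_of_tendsto (b := nhdsWithin r B)
        (tendsto_const_nhds.dist (hfr.mono hBI))
        (((continuous_const.mul (continuous_id.sub continuous_const)).tendsto r).mono_left
          nhdsWithin_le_nhds) ?_
      filter_upwards [self_mem_nhdsWithin] with u hu
      have := hA i hiS s ⟨hsi, hs⟩ u ⟨hu.1, hBI hu⟩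
      rwa [dist_comm s u, Real.dist_eq, abs_of_nonneg (sub_nonneg.2 hu.2.1)] at this
    have h2 : dist (f r) (f t) ≤ K * (t - r) := by
      rcases hrt.eq_or_lt with h | h
      · simp [h]
      have hJI : Ioc r t ⊆ I := fun u hu => hsub ⟨hsr.trans hu.1.le, hu.2⟩
      have : (nhdsWithin r (Ioc r t)).NeBot := by
        rw [nhdsWithin_Ioc_eq_nhdsGT h]; infer_instance
      refine le_of_tendsto_of_tendsto (b := nhdsWithin r (Ioc r t))
        ((hfr.mono hJI).dist tendsto_const_nhds)
        (((continuous_const.mul (continuous_const.sub continuous_id)).tendsto r).mono_left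
          nhdsWithin_le_nhds) ?_
      filter_upwards [self_mem_nhdsWithin] with u hu
      refine ih (S.erase i) (Finset.erase_ssubset hiS)
        (fun j hj => hA j (Finset.mem_of_mem_erase hj)) (hJI hu) hu.2 fun v hv => ?_
      have hv' : v ∈ Icc s t := ⟨hsr.trans (hu.1.le.trans hv.1), hv.2⟩
      obtain ⟨j, hjS, hj⟩ := hcov v hv'
      refine ⟨j, Finset.mem_erase.2 ⟨?_, hjS⟩, hj⟩
      rintro rfl
      exact absurd (le_csSup hbdd ⟨hj, hv'⟩) (not_le.2 (hu.1.trans_le hv.1))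
    linarith [dist_triangle (f s) (f r) (f t)]

/-- Polynomial functions are stable under precomposition with linear maps. -/
theorem MvPolynomial.exists_eval_eq_eval_linearMap {R ι : Type*} [CommSemiring R] [Fintype ι]
    (L : (ι → R) →ₗ[R] (ι → R)) (q : MvPolynomial ι R) :
    ∃ p : MvPolynomial ι R, ∀ x, eval x p = eval (L x) q := by
  classical
  refine ⟨bind₁ (fun i => ∑ j, C (L (Pi.single j 1) i) * X j) q, fun x => ?_⟩
  rw [← coe_aeval_eq_eval, RingHom.coe_coe, aeval_bind₁, ← coe_aeval_eq_eval, RingHom.coe_coe]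
  congr 2
  funext i
  conv_rhs => rw [pi_eq_sum_univ' x]
  simp [mul_comm]

/-- For points `x` and `y` in distinct orbits of a finite group there is an invariant polynomial
which vanishes at `x` and equals `1` at `y`. -/
theorem MvPolynomial.exists_invariant_separating {k ι G : Type*} [Field k] [Fintype ι] [Group G]
    [Fintype G] (ρ : G →* ((ι → k) ≃ₗ[k] (ι → k))) {x y : ι → k} (h : ∀ g, ρ g y ≠ x) :
    ∃ f : MvPolynomial ι k, (∀ g z, eval (ρ g z) f = eval z f) ∧ eval x f = 0 ∧ eval y f = 1 := by
  choose j hj using fun g => Function.ne_iff.1 (h g)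
  let q : MvPolynomial ι k :=
    1 - ∏ g, C (x (j g) - ρ g y (j g))⁻¹ * (X (j g) - C (ρ g y (j g)))
  have hqx : eval x q = 0 := by
    simp only [q, map_sub, map_one, map_prod, map_mul, eval_C, eval_X]
    rw [Finset.prod_eq_one, sub_self]
    exact fun g _ => inv_mul_cancel₀ (sub_ne_zero.2 (hj g).symm)
  have hqy (g : G) : eval (ρ g y) q = 1 := by
    simp only [q, map_sub, map_one, map_prod, map_mul, eval_C, eval_X]
    rw [Finset.prod_eq_zero (Finset.mem_univ g) (by simp), sub_zero]
  choose p hp using fun g => exists_eval_eq_eval_linearMap (ρ g).toLinearMap q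
  refine ⟨∏ g, p g, fun g z => ?_, ?_, ?_⟩
  · simp only [map_prod, hp]
    exact Fintype.prod_equiv (Equiv.mulRight g) _ _ fun a => by simp
  · rw [map_prod]
    exact Finset.prod_eq_zero (Finset.mem_univ 1) (by simp [hp, hqx])
  · simp [map_prod, hp, hqy]

/-- If a continuous curve in `σ(ℂ^m)` admits a Lipschitz lift, then every
continuous lift is Lipschitz. -/
theorem stmt2
    {m n : ℕ} {G : Type} [Group G] [Fintype G]
    (ρ : G →* ((Fin m → ℂ) ≃ₗ[ℂ] (Fin m → ℂ)))
    (σ : Fin n → MvPolynomial (Fin m) ℂ) (deg : Fin n → ℕ)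
    (hdeg : ∀ k, 1 ≤ deg k)
    (hhom : ∀ k, (σ k).IsHomogeneous (deg k))
    (hinv : ∀ k g x, MvPolynomial.eval (ρ g x) (σ k) = MvPolynomial.eval x (σ k))
    (hgen : ∀ f : MvPolynomial (Fin m) ℂ,
      (∀ g x, MvPolynomial.eval (ρ g x) f = MvPolynomial.eval x f) →
      ∃ p : MvPolynomial (Fin n) ℂ, MvPolynomial.aeval σ p = f)
    (σm : (Fin m → ℂ) → (Fin n → ℂ))
    (hσm : ∀ x k, σm x k = MvPolynomial.eval x (σ k))
    (I : Set ℝ) (hI : I.OrdConnected)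
    (c : ℝ → Fin n → ℂ) (hc : ContinuousOn c I)
    (hcσ : ∀ t ∈ I, ∃ x : Fin m → ℂ, σm x = c t)
    (ct : ℝ → Fin m → ℂ) (K : NNReal) (hct : LipschitzOnWith K ct I)
    (hctlift : ∀ t ∈ I, σm (ct t) = c t)
    (cb : ℝ → Fin m → ℂ) (hcb : ContinuousOn cb I)
    (hcblift : ∀ t ∈ I, σm (cb t) = c t) :
    ∃ K' : NNReal, LipschitzOnWith K' cb I := by
  have horbit (x y : Fin m → ℂ) (hxy : σm x = σm y) : ∃ g, ρ g y = x := by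
    by_contra! h
    obtain ⟨f, hf, hfx, hfy⟩ := MvPolynomial.exists_invariant_separating ρ h
    obtain ⟨p, rfl⟩ := hgen f hf
    have key (z : Fin m → ℂ) :
        MvPolynomial.eval z (MvPolynomial.aeval σ p) = MvPolynomial.eval (σm z) p := by
      rw [MvPolynomial.aeval_eq_bind₁, ← MvPolynomial.coe_aeval_eq_eval, RingHom.coe_coe,
        MvPolynomial.aeval_bind₁, ← MvPolynomial.coe_aeval_eq_eval, RingHom.coe_coe]
      congr 2
      funext k
      rw [hσm, ← MvPolynomial.coe_aeval_eq_eval, RingHom.coe_coe]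
    rw [key] at hfx hfy
    rw [hxy, hfy] at hfx
    exact one_ne_zero hfx
  let L (g : G) : (Fin m → ℂ) →L[ℂ] (Fin m → ℂ) := (ρ g).toLinearMap.toContinuousLinearMap
  let M : NNReal := (∑ g, ‖L g‖₊) * K
  have hle : ∀ s ∈ I, ∀ t ∈ I, s ≤ t → dist (cb s) (cb t) ≤ M * (t - s) := by
    intro s hs t ht hst
    refine dist_le_mul_of_finite_cover (fun g => {u | ρ g (ct u) = cb u}) Finset.univ hI hcb
      ?_ hs ht hst fun u hu => ?_
    · rintro g - u ⟨hu, huI⟩ v ⟨hv, hvI⟩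
      rw [← show L g (ct u) = cb u from hu, ← show L g (ct v) = cb v from hv]
      have hLM : ‖L g‖₊ ≤ ∑ g, ‖L g‖₊ :=
        Finset.single_le_sum (f := fun g => ‖L g‖₊) (fun _ _ => zero_le) (Finset.mem_univ g)
      calc dist (L g (ct u)) (L g (ct v))
          ≤ ‖L g‖₊ * dist (ct u) (ct v) := (L g).lipschitz.dist_le_mul _ _
        _ ≤ (∑ g, ‖L g‖₊ : NNReal) * (K * dist u v) := by
            gcongr
            exact hct.dist_le_mul u huI v hvI
        _ = M * dist u v := by simp [M, mul_assoc]
    · have huI := hI.out hs ht hu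
      obtain ⟨g, hg⟩ := horbit (cb u) (ct u) ((hcblift u huI).trans (hctlift u huI).symm)
      exact ⟨g, Finset.mem_univ g, hg⟩
  refine ⟨M, LipschitzOnWith.of_dist_le_mul fun s hs t ht => ?_⟩
  rcases le_total s t with h | h
  · rw [dist_comm s t, Real.dist_eq, abs_of_nonneg (sub_nonneg.2 h)]
    exact hle s hs t ht h
  · rw [dist_comm (cb s), Real.dist_eq, abs_of_nonneg (sub_nonneg.2 h)]
    exact hle t ht s hs h
end

section
/- Let I ⊆ ℝ be an open interval, t₀ ∈ I, and let c : I → ℂ^n be a real-analytic curve with c(t) ∈ σ(ℂ^m) for all t ∈ I. Then there exist a positive integer N, a δ > 0, and real-analytic curves c̄⁺, c̄⁻ : (t₀−δ, t₀+δ) → ℂ^m such that t₀ ± (t−t₀)^N ∈ I and σ(c̄^±(t)) = c(t₀ ± (t−t₀)^N) for all t ∈ (t₀−δ, t₀+δ). (This is the paper's Puiseux-type main theorem in the case of a finite group and the quasianalytic class C^ω; real-analytic curves are automatically normally nonflat.) -/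
open MeasureTheory Set Filter
open Polynomial Topology

/-- The monic polynomial of degree `d` whose lower coefficients are given by `a`. -/
noncomputable def monicOfFn {d : ℕ} (a : Fin d → ℂ) : ℂ[X] := X ^ d + ofFn d a

theorem monic_monicOfFn {d : ℕ} (a : Fin d → ℂ) : (monicOfFn a).Monic :=
  monic_X_pow_add (ofFn_degree_lt a)

theorem degree_monicOfFn {d : ℕ} (a : Fin d → ℂ) : (monicOfFn a).degree = d := by
  rw [monicOfFn, degree_add_eq_left_of_degree_lt] <;> simp [ofFn_degree_lt]

theorem natDegree_monicOfFn {d : ℕ} (a : Fin d → ℂ) : (monicOfFn a).natDegree = d :=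
  natDegree_eq_of_degree_eq_some (degree_monicOfFn a)

theorem coeff_monicOfFn {d : ℕ} (a : Fin d → ℂ) (i : Fin d) : (monicOfFn a).coeff i = a i := by
  simp [monicOfFn, coeff_X_pow, i.2.ne]

theorem monicOfFn_coeff {d : ℕ} {P : ℂ[X]} (hP : P.Monic) (hd : P.natDegree = d) :
    monicOfFn (fun i : Fin d => P.coeff i) = P := by
  ext k
  rcases lt_trichotomy k d with h | rfl | h
  · exact coeff_monicOfFn _ ⟨k, h⟩
  · rw [← hd, hP.coeff_natDegree, hd]
    simpa [natDegree_monicOfFn] using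
      (monic_monicOfFn (fun i : Fin k => P.coeff i)).coeff_natDegree
  · rw [coeff_eq_zero_of_natDegree_lt (by rwa [natDegree_monicOfFn]),
      coeff_eq_zero_of_natDegree_lt (by omega)]

/-- Coefficients of the product of two monic polynomials. -/
noncomputable def mulCoeff {p q : ℕ} (x : (Fin p → ℂ) × (Fin q → ℂ)) (i : Fin (p + q)) : ℂ :=
  (monicOfFn x.1 * monicOfFn x.2).coeff i

theorem monicOfFn_mulCoeff {p q : ℕ} (x : (Fin p → ℂ) × (Fin q → ℂ)) :
    monicOfFn (mulCoeff x) = monicOfFn x.1 * monicOfFn x.2 :=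
  monicOfFn_coeff ((monic_monicOfFn _).mul (monic_monicOfFn _)) (by
    rw [(monic_monicOfFn _).natDegree_mul (monic_monicOfFn _)]; simp [natDegree_monicOfFn])

theorem contDiff_coeff_monicOfFn {d : ℕ} (k : ℕ) :
    ContDiff ℂ ⊤ fun a : Fin d → ℂ => (monicOfFn a).coeff k := by
  have h : ContDiff ℂ ⊤ fun a : Fin d → ℂ => (ofFn d a).coeff k :=
    ((lcoeff ℂ k ∘ₗ ofFn d).toContinuousLinearMap).contDiff
  simpa [monicOfFn] using contDiff_const.add h

theorem contDiff_mulCoeff {p q : ℕ} : ContDiff ℂ ⊤ (mulCoeff (p := p) (q := q)) := by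
  refine contDiff_pi.2 fun i => ?_
  simp only [mulCoeff, coeff_mul]
  exact ContDiff.sum fun k _ => ((contDiff_coeff_monicOfFn k.1).comp contDiff_fst).mul
    ((contDiff_coeff_monicOfFn k.2).comp contDiff_snd)

theorem fderiv_mulCoeff {p q : ℕ} (x w : (Fin p → ℂ) × (Fin q → ℂ)) (i : Fin (p + q)) :
    fderiv ℂ mulCoeff x w i =
      (ofFn p w.1 * monicOfFn x.2 + monicOfFn x.1 * ofFn q w.2).coeff i := by
  have h1 : HasFDerivAt mulCoeff (fderiv ℂ mulCoeff x) (x + (0 : ℂ) • w) := by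
    simpa using (contDiff_mulCoeff.differentiable (by simp) x).hasFDerivAt
  have h2 : HasDerivAt (fun t : ℂ => x + t • w) w 0 := by
    simpa using ((hasDerivAt_id (0 : ℂ)).smul_const w).const_add x
  have h3 := hasDerivAt_pi.1 (h1.comp_hasDerivAt (0 : ℂ) h2) i
  set A := (monicOfFn x.1 * monicOfFn x.2).coeff i
  set B := (ofFn p w.1 * monicOfFn x.2 + monicOfFn x.1 * ofFn q w.2).coeff i
  set D := (ofFn p w.1 * ofFn q w.2).coeff i
  have h4 : HasDerivAt (fun t : ℂ => A + t * B + t ^ 2 * D) B 0 := by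
    have h := (((hasDerivAt_id' (0 : ℂ)).mul_const B).const_add A).fun_add
      (((hasDerivAt_id' (0 : ℂ)).fun_pow 2).mul_const D)
    exact h.congr_deriv (by simp)
  refine h3.unique (h4.congr_of_eventuallyEq (.of_forall fun t => ?_))
  simp only [Function.comp, mulCoeff, A, B, D, ← coeff_C_mul, ← coeff_add]
  congr 1
  simp only [monicOfFn, Prod.fst_add, Prod.snd_add, Prod.smul_fst, Prod.smul_snd, map_add,
    map_smul, smul_eq_C_mul, C_pow]
  ring

theorem injective_fderiv_mulCoeff {p q : ℕ} (x : (Fin p → ℂ) × (Fin q → ℂ))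
    (hx : IsCoprime (monicOfFn x.1) (monicOfFn x.2)) :
    Function.Injective (fderiv ℂ mulCoeff x) := by
  refine (injective_iff_map_eq_zero _).2 fun w hw => ?_
  have hz : ofFn p w.1 * monicOfFn x.2 + monicOfFn x.1 * ofFn q w.2 = 0 := by
    ext k
    by_cases hk : k < p + q
    · rw [coeff_zero, ← fderiv_mulCoeff x w ⟨k, hk⟩, hw]; rfl
    · refine coeff_eq_zero_of_degree_lt (lt_of_lt_of_le ?_ (Nat.cast_le.2 (not_lt.1 hk)))
      refine (degree_add_le _ _).trans_lt (max_lt ?_ ?_)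
      · rw [(monic_monicOfFn _).degree_mul, degree_monicOfFn, Nat.cast_add]
        exact WithBot.add_lt_add_right (WithBot.natCast_ne_bot _) (ofFn_degree_lt _)
      · rw [mul_comm, (monic_monicOfFn _).degree_mul, degree_monicOfFn, add_comm, Nat.cast_add]
        exact WithBot.add_lt_add_left (WithBot.natCast_ne_bot _) (ofFn_degree_lt _)
  have h1 : ofFn p w.1 = 0 := by
    refine eq_zero_of_dvd_of_degree_lt (p := monicOfFn x.1) ?_ ?_
    · exact hx.dvd_of_dvd_mul_right ⟨-ofFn q w.2, by linear_combination hz⟩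
    · rw [degree_monicOfFn]
      exact ofFn_degree_lt _
  have h2 : ofFn q w.2 = 0 := by
    rw [h1, zero_mul, zero_add] at hz
    exact (mul_eq_zero.1 hz).resolve_left (monic_monicOfFn _).ne_zero
  ext i
  · simpa using congr_arg (coeff · i) h1
  · simpa using congr_arg (coeff · i) h2

theorem monicOfFn_injective {d : ℕ} : Function.Injective (monicOfFn (d := d)) := fun a b h =>
  funext fun i => by rw [← coeff_monicOfFn a, h, coeff_monicOfFn]

theorem analyticAt_coeff_monicOfFn {d : ℕ} {a : ℝ → Fin d → ℂ} {t : ℝ} (ha : AnalyticAt ℝ a t)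
    (k : ℕ) : AnalyticAt ℝ (fun s => (monicOfFn (a s)).coeff k) t :=
  (contDiff_coeff_monicOfFn k).contDiffAt.analyticAt.restrictScalars.comp ha

/-- Hensel's lemma: a coprime factorization of a monic polynomial extends analytically
to all nearby monic polynomials. -/
theorem exists_analyticAt_factorization {p q d : ℕ} (hpq : p + q = d)
    (x : (Fin p → ℂ) × (Fin q → ℂ)) (hx : IsCoprime (monicOfFn x.1) (monicOfFn x.2))
    {a₀ : Fin d → ℂ} (ha₀ : monicOfFn a₀ = monicOfFn x.1 * monicOfFn x.2) :
    ∃ Ψ : (Fin d → ℂ) → (Fin p → ℂ) × (Fin q → ℂ), AnalyticAt ℂ Ψ a₀ ∧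
      ∀ᶠ a in 𝓝 a₀, monicOfFn a = monicOfFn (Ψ a).1 * monicOfFn (Ψ a).2 := by
  subst hpq
  obtain rfl : a₀ = mulCoeff x := monicOfFn_injective (by rw [ha₀, monicOfFn_mulCoeff])
  let e : ((Fin p → ℂ) × (Fin q → ℂ)) ≃L[ℂ] (Fin (p + q) → ℂ) :=
    (LinearEquiv.ofInjectiveOfFinrankEq (fderiv ℂ mulCoeff x).toLinearMap
      (injective_fderiv_mulCoeff x hx) (by simp)).toContinuousLinearEquiv
  have hs : ContDiffAt ℂ ⊤ (mulCoeff (p := p) (q := q)) x := contDiff_mulCoeff.contDiffAt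
  have he : HasFDerivAt mulCoeff (e : _ →L[ℂ] _) x := by
    have h : (e : _ →L[ℂ] _) = fderiv ℂ mulCoeff x :=
      ContinuousLinearMap.ext fun _ => rfl
    rw [h]
    exact (contDiff_mulCoeff.differentiable (by simp) x).hasFDerivAt
  refine ⟨hs.localInverse he (by simp), ?_, ?_⟩
  · exact (hs.to_localInverse he (by simp)).analyticAt
  · filter_upwards [(hs.hasStrictFDerivAt' he (by simp)).eventually_right_inverse] with a ha
    conv_lhs => rw [← ha]
    exact monicOfFn_mulCoeff _

/-- `P` splits into analytic linear factors near `0` after a substitution `t = s ^ N`. -/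
def PuiseuxSplits (P : ℝ → ℂ[X]) : Prop :=
  ∃ (N : ℕ) (L : List (ℝ → ℂ)), 0 < N ∧ (∀ r ∈ L, AnalyticAt ℝ r 0) ∧
    ∀ᶠ s in 𝓝 (0 : ℝ), P (s ^ N) = (L.map fun r => X - C (r s)).prod

theorem tendsto_pow_nhds_zero {N : ℕ} (hN : 0 < N) :
    Tendsto (fun s : ℝ => s ^ N) (𝓝 0) (𝓝 0) := by
  simpa [hN.ne'] using (continuous_pow N).tendsto (0 : ℝ)

theorem AnalyticAt.comp_pow_zero {E : Type*} [NormedAddCommGroup E] [NormedSpace ℝ E]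
    {f : ℝ → E} (hf : AnalyticAt ℝ f 0) {N : ℕ} (hN : 0 < N) :
    AnalyticAt ℝ (fun s => f (s ^ N)) 0 :=
  AnalyticAt.fun_comp (g := f) (f := fun s : ℝ => s ^ N) (by simpa [hN.ne'] using hf)
    (analyticAt_id.pow N)

namespace PuiseuxSplits

theorem congr {P Q : ℝ → ℂ[X]} (hQ : PuiseuxSplits Q) (h : P =ᶠ[𝓝 0] Q) :
    PuiseuxSplits P := by
  obtain ⟨N, L, hN, hL, hQ⟩ := hQ
  refine ⟨N, L, hN, hL, ?_⟩
  filter_upwards [hQ, (tendsto_pow_nhds_zero hN).eventually h] with s h1 h2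
  rw [h2, h1]

theorem one : PuiseuxSplits fun _ => 1 :=
  ⟨1, [], one_pos, by simp, by simp⟩

theorem mul {P Q : ℝ → ℂ[X]} (hP : PuiseuxSplits P) (hQ : PuiseuxSplits Q) :
    PuiseuxSplits fun t => P t * Q t := by
  obtain ⟨N, L, hN, hL, hP⟩ := hP
  obtain ⟨M, K, hM, hK, hQ⟩ := hQ
  refine ⟨N * M, L.map (fun r s => r (s ^ M)) ++ K.map (fun r s => r (s ^ N)),
    Nat.mul_pos hN hM, ?_, ?_⟩
  · intro r hr
    simp only [List.mem_append, List.mem_map] at hr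
    rcases hr with ⟨u, hu, rfl⟩ | ⟨u, hu, rfl⟩
    · exact (hL u hu).comp_pow_zero hM
    · exact (hK u hu).comp_pow_zero hN
  · filter_upwards [(tendsto_pow_nhds_zero hM).eventually hP,
      (tendsto_pow_nhds_zero hN).eventually hQ] with s h1 h2
    rw [← pow_mul, mul_comm M] at h1
    rw [← pow_mul] at h2
    simp [h1, h2, Function.comp_def]

theorem prod {ι : Type*} (S : Finset ι) {P : ι → ℝ → ℂ[X]} (h : ∀ i, PuiseuxSplits (P i)) :
    PuiseuxSplits fun t => ∏ i ∈ S, P i t := by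
  classical
  induction S using Finset.induction_on with
  | empty => simpa using one
  | insert i S hi ih => simpa [Finset.prod_insert hi] using (h i).mul ih

theorem of_comp_pow {P : ℝ → ℂ[X]} {k : ℕ} (hk : 0 < k)
    (h : PuiseuxSplits fun s => P (s ^ k)) : PuiseuxSplits P := by
  obtain ⟨N, L, hN, hL, h⟩ := h
  exact ⟨N * k, L, Nat.mul_pos hN hk, hL, by simpa only [pow_mul] using h⟩

theorem scaleRoots {P : ℝ → ℂ[X]} (hP : PuiseuxSplits P) (k : ℕ) :
    PuiseuxSplits fun s => (P s).scaleRoots ((s : ℂ) ^ k) := by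
  obtain ⟨N, L, hN, hL, hP⟩ := hP
  refine ⟨N, L.map (fun r s => r s * ((s ^ N : ℝ) : ℂ) ^ k), hN, ?_, ?_⟩
  · intro r hr
    obtain ⟨u, hu, rfl⟩ := List.mem_map.1 hr
    refine (hL u hu).mul (AnalyticAt.pow ?_ k)
    exact (Complex.ofRealCLM.analyticAt _).comp (analyticAt_id.pow N)
  · filter_upwards [hP] with s h
    rw [h, List.map_map]
    clear h hP hL
    induction L with
    | nil => simp
    | cons r L ih =>
      rw [List.map_cons, List.prod_cons, List.map_cons, List.prod_cons, ← ih,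
        mul_scaleRoots_of_noZeroDivisors, X_sub_C_scaleRoots]
      simp

theorem of_taylor {P : ℝ → ℂ[X]} {α : ℝ → ℂ} (hα : AnalyticAt ℝ α 0)
    (h : PuiseuxSplits fun t => taylor (α t) (P t)) : PuiseuxSplits P := by
  obtain ⟨N, L, hN, hL, h⟩ := h
  refine ⟨N, L.map (fun r s => r s + α (s ^ N)), hN, ?_, ?_⟩
  · intro r hr
    obtain ⟨u, hu, rfl⟩ := List.mem_map.1 hr
    exact (hL u hu).add (hα.comp_pow_zero hN)
  · filter_upwards [h] with s hs
    apply taylor_injective (α (s ^ N))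
    refine hs.trans ?_
    rw [List.map_map]
    clear hs h hL
    induction L with
    | nil => simp
    | cons r L ih =>
      rw [List.map_cons, List.prod_cons, List.map_cons, List.prod_cons, taylor_mul, ← ih]
      simp

end PuiseuxSplits

theorem exists_isCoprime_mul_of_coeff {d : ℕ} {P : ℂ[X]} (hP : P.Monic) (hd : P.natDegree = d + 1)
    (h0 : P.coeff d = 0) (hne : ∃ i < d, P.coeff i ≠ 0) :
    ∃ (p q : ℕ) (x : (Fin p → ℂ) × (Fin q → ℂ)), p < d + 1 ∧ q < d + 1 ∧ p + q = d + 1 ∧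
      IsCoprime (monicOfFn x.1) (monicOfFn x.2) ∧ P = monicOfFn x.1 * monicOfFn x.2 := by
  obtain ⟨z, hz⟩ := IsAlgClosed.exists_root P
    (by rw [degree_eq_natDegree hP.ne_zero, hd]; exact_mod_cast d.succ_ne_zero)
  obtain ⟨Q, hPQ, hQ⟩ := P.exists_eq_pow_rootMultiplicity_mul_and_not_dvd hP.ne_zero z
  set k := P.rootMultiplicity z with hk
  have hkpos : 0 < k := (rootMultiplicity_pos hP.ne_zero).2 hz
  have hm : ((X - C z) ^ k).Monic := (monic_X_sub_C z).pow k
  have hQm : Q.Monic := hm.of_mul_monic_left (hPQ ▸ hP)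
  have hdeg : k + Q.natDegree = d + 1 := by
    rw [← hd, hPQ, hm.natDegree_mul hQm, (monic_X_sub_C z).natDegree_pow]; simp
  have hQpos : 0 < Q.natDegree := by
    by_contra hcon
    have hQ1 : Q = 1 := hQm.natDegree_eq_zero.1 (by omega)
    have hkd : k = d + 1 := by omega
    rw [hQ1, mul_one, hkd] at hPQ
    have hz0 : z = 0 := by
      rw [hPQ, sub_eq_add_neg, ← C_neg, coeff_X_add_C_pow] at h0
      have : (d + 1 : ℂ) ≠ 0 := by exact_mod_cast d.succ_ne_zero
      simpa [this] using h0
    obtain ⟨i, hi, hi0⟩ := hne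
    rw [hPQ, hz0] at hi0
    simp [coeff_X_pow] at hi0
    omega
  have hcop : IsCoprime ((X - C z) ^ k) Q :=
    IsCoprime.pow_left ((irreducible_X_sub_C z).coprime_iff_not_dvd.2 hQ)
  have e1 := monicOfFn_coeff hm (d := k) (by rw [(monic_X_sub_C z).natDegree_pow]; simp)
  have e2 := monicOfFn_coeff hQm rfl
  refine ⟨k, Q.natDegree, (fun i => ((X - C z) ^ k).coeff i, fun i => Q.coeff i),
    by omega, by omega, hdeg, ?_, ?_⟩
  · simp only
    rw [e1, e2]; exact hcop
  · simp only
    rw [e1, e2]; exact hPQ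

theorem coeff_taylor_eq_sum {d : ℕ} {P : ℂ[X]} (hd : P.natDegree = d) (z : ℂ) (i : ℕ) :
    (taylor z P).coeff i =
      ∑ j ∈ Finset.range (d + 1), P.coeff j * (z ^ (j - i) * (j.choose i : ℂ)) := by
  conv_lhs => rw [P.as_sum_range_C_mul_X_pow, hd]
  simp [taylor_mul, coeff_X_add_C_pow]

theorem analyticAt_coeff_taylor {d : ℕ} {P : ℝ → ℂ[X]} (hd : ∀ t, (P t).natDegree = d)
    (hP : ∀ i, AnalyticAt ℝ (fun t => (P t).coeff i) 0) {α : ℝ → ℂ} (hα : AnalyticAt ℝ α 0)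
    (i : ℕ) : AnalyticAt ℝ (fun t => (taylor (α t) (P t)).coeff i) 0 := by
  simp only [fun t => coeff_taylor_eq_sum (hd t) (α t) i]
  exact Finset.analyticAt_fun_sum _ fun j _ => (hP j).mul ((hα.pow _).mul analyticAt_const)

/-- Newton polygon step: analytic functions which are not all germwise zero become, after a
ramification, multiples of suitable powers of the parameter, with one nonvanishing quotient. -/
theorem exists_rescaling {d : ℕ} (a : Fin d → ℝ → ℂ) (ha : ∀ i, AnalyticAt ℝ (a i) 0)
    (hne : ∃ i, ¬ ∀ᶠ t in 𝓝 (0 : ℝ), a i t = 0) :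
    ∃ (M ν : ℕ) (b : Fin d → ℝ → ℂ), 0 < M ∧ (∀ i, AnalyticAt ℝ (b i) 0) ∧
      (∃ i, b i 0 ≠ 0) ∧ (∀ i, (∀ t, a i t = 0) → b i = 0) ∧
      ∀ᶠ s in 𝓝 (0 : ℝ), ∀ i, a i (s ^ M) = b i s * ((s : ℂ) ^ ν) ^ (d - i) := by
  classical
  have key : ∀ i, ∃ (m : ℕ) (g : ℝ → ℂ), (¬ (∀ᶠ t in 𝓝 (0 : ℝ), a i t = 0)) →
      AnalyticAt ℝ g 0 ∧ g 0 ≠ 0 ∧ ∀ᶠ t in 𝓝 (0 : ℝ), a i t = (t : ℂ) ^ m * g t := by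
    intro i
    by_cases h : ∀ᶠ t in 𝓝 (0 : ℝ), a i t = 0
    · exact ⟨0, 0, fun h' => (h' h).elim⟩
    · obtain ⟨m, g, h1, h2, h3⟩ := (ha i).exists_eventuallyEq_pow_smul_nonzero_iff.2 h
      exact ⟨m, g, fun _ => ⟨h1, h2, by simpa using h3⟩⟩
  choose m g hg using key
  set S : Finset (Fin d) := Finset.univ.filter fun i => ¬ ∀ᶠ t in 𝓝 (0 : ℝ), a i t = 0 with hS
  have memS : ∀ i, i ∈ S ↔ ¬ ∀ᶠ t in 𝓝 (0 : ℝ), a i t = 0 := by simp [hS]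
  obtain ⟨i₀, hi₀, hmin⟩ := S.exists_min_image (fun i => d.factorial / (d - i) * m i)
    (by obtain ⟨i, hi⟩ := hne; exact ⟨i, (memS i).2 hi⟩)
  set ν := d.factorial / (d - i₀) * m i₀ with hν
  have hfac : ∀ i : Fin d, d.factorial / (d - i) * m i * (d - i) = d.factorial * m i := by
    intro i
    have : d.factorial / (d - i) * (d - i) = d.factorial :=
      Nat.div_mul_cancel (Nat.dvd_factorial (by omega) (by omega))
    rw [mul_right_comm, this]
  have hle : ∀ i ∈ S, ν * (d - i) ≤ d.factorial * m i := fun i hi => by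
    rw [← hfac i]; exact Nat.mul_le_mul_right _ (hmin i hi)
  have hM : 0 < d.factorial := d.factorial_pos
  refine ⟨d.factorial, ν, fun i => if i ∈ S then fun s =>
    (s : ℂ) ^ (d.factorial * m i - ν * (d - i)) * g i (s ^ d.factorial) else 0, hM, ?_,
    ⟨i₀, ?_⟩, ?_, ?_⟩
  · intro i
    by_cases hi : i ∈ S
    · simp only [if_pos hi]
      exact ((Complex.ofRealCLM.analyticAt _).pow _).mul
        ((hg i ((memS i).1 hi)).1.comp_pow_zero hM)
    · simp only [if_neg hi]
      exact analyticAt_const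
  · simpa [hi₀, hν, hfac, hM.ne'] using (hg i₀ ((memS i₀).1 hi₀)).2.1
  · intro i hi
    exact if_neg fun h => (memS i).1 h (.of_forall hi)
  · refine eventually_all.2 fun i => ?_
    by_cases hi : i ∈ S
    · filter_upwards [(tendsto_pow_nhds_zero hM).eventually (hg i ((memS i).1 hi)).2.2] with s hs
      rw [hs, if_pos hi, Complex.ofReal_pow, ← pow_mul, ← pow_mul, mul_right_comm, ← pow_add,
        Nat.sub_add_cancel (hle i hi)]
    · filter_upwards [(tendsto_pow_nhds_zero hM).eventually
        (not_not.1 (mt (memS i).2 hi))] with s hs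
      rw [hs, if_neg hi]; simp

/-- **Puiseux's theorem** for monic polynomials with real-analytic complex coefficients. -/
theorem puiseuxSplits_of_analyticAt (d : ℕ) {P : ℝ → ℂ[X]} (hm : ∀ t, (P t).Monic)
    (hd : ∀ t, (P t).natDegree = d) (hP : ∀ i, AnalyticAt ℝ (fun t => (P t).coeff i) 0) :
    PuiseuxSplits P := by
  induction d using Nat.strong_induction_on generalizing P with
  | _ d ih =>
  rcases d with _ | d
  · exact PuiseuxSplits.one.congr (.of_forall fun t => (hm t).natDegree_eq_zero.1 (hd t))
  set α : ℝ → ℂ := fun t => -(P t).coeff d / (d + 1) with hα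
  have hαan : AnalyticAt ℝ α 0 := (hP d).neg.div_const
  refine PuiseuxSplits.of_taylor hαan ?_
  set Q : ℝ → ℂ[X] := fun t => taylor (α t) (P t) with hQ
  have hQd : ∀ t, (Q t).natDegree = d + 1 := fun t => by rw [hQ, natDegree_taylor, hd]
  have hQm : ∀ t, (Q t).Monic := fun t => by
    rw [Monic, hQ, leadingCoeff_taylor]; exact hm t
  have hQan : ∀ i, AnalyticAt ℝ (fun t => (Q t).coeff i) 0 :=
    analyticAt_coeff_taylor hd hP hαan
  have hQ0 : ∀ t, (Q t).coeff d = 0 := by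
    intro t
    have h1 : (P t).coeff (d + 1) = 1 := by rw [← hd t]; exact hm t
    have hsum : ∀ j ∈ Finset.range d,
        (P t).coeff j * (α t ^ (j - d) * (j.choose d : ℂ)) = 0 := fun j hj => by
      rw [Nat.choose_eq_zero_of_lt (Finset.mem_range.1 hj)]; simp
    rw [hQ, coeff_taylor_eq_sum (hd t), Finset.sum_range_succ, Finset.sum_range_succ,
      Finset.sum_eq_zero hsum, h1]
    simp only [hα]
    simp
    field_simp
    ring
  by_cases hz : ∀ i : Fin (d + 1), ∀ᶠ t in 𝓝 (0 : ℝ), (Q t).coeff i = 0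
  · refine ⟨1, List.replicate (d + 1) 0, one_pos, ?_, ?_⟩
    · intro r hr
      rw [List.eq_of_mem_replicate hr]; exact analyticAt_const
    · filter_upwards [eventually_all.2 hz] with t ht
      rw [pow_one, ← monicOfFn_coeff (hQm t) (hQd t), funext ht]
      simp [monicOfFn, ← Pi.zero_def]
  push Not at hz
  obtain ⟨M, ν, b, hM, hb, ⟨i₀, hi₀⟩, hb0, hab⟩ :=
    exists_rescaling (fun (i : Fin (d + 1)) t => (Q t).coeff i) (fun i => hQan i)
      (by simpa using hz)
  refine PuiseuxSplits.of_comp_pow hM ?_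
  suffices h : PuiseuxSplits fun s => monicOfFn fun i => b i s by
    refine (h.scaleRoots ν).congr ?_
    filter_upwards [hab] with s hs
    rw [← monicOfFn_coeff (hQm _) (hQd (s ^ M)), ← monicOfFn_coeff (d := d + 1)
      ((monic_scaleRoots_iff _).2 (monic_monicOfFn fun i => b i s))
      (by rw [natDegree_scaleRoots, natDegree_monicOfFn])]
    congr 1
    funext i
    rw [hs, coeff_scaleRoots, natDegree_monicOfFn, coeff_monicOfFn]
  obtain ⟨p, q, x, hp, hq, hpq, hcop, hx⟩ :=
    exists_isCoprime_mul_of_coeff (d := d) (monic_monicOfFn fun i => b i 0)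
      (natDegree_monicOfFn _) (by
        refine (coeff_monicOfFn _ (Fin.last d)).trans ?_
        rw [hb0 (Fin.last d) hQ0]; rfl)
      (by
        refine ⟨i₀, lt_of_le_of_ne (by omega) fun h => hi₀ ?_, by rwa [coeff_monicOfFn]⟩
        rw [hb0 i₀ (by simpa [h] using hQ0)]; rfl)
  obtain ⟨Ψ, hΨ, hΨe⟩ := exists_analyticAt_factorization hpq x hcop hx
  have hB : AnalyticAt ℝ (fun s i => b i s) 0 := analyticAt_pi_iff.2 hb
  have hΨB : AnalyticAt ℝ (fun s => Ψ fun i => b i s) 0 :=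
    AnalyticAt.fun_comp (g := Ψ) (f := fun s i => b i s) hΨ.restrictScalars hB
  refine ((ih p hp (fun _ => monic_monicOfFn _) (fun _ => natDegree_monicOfFn _)
    (analyticAt_coeff_monicOfFn (analyticAt_fst.fun_comp hΨB))).mul
    (ih q hq (fun _ => monic_monicOfFn _) (fun _ => natDegree_monicOfFn _)
    (analyticAt_coeff_monicOfFn (analyticAt_snd.fun_comp hΨB)))).congr ?_
  exact hB.continuousAt.eventually hΨe

/-- Each coordinate is a root of a monic polynomial whose coefficients are polynomials in a
generating system of invariants. -/
theorem exists_isRoot_monicOfFn_of_invariants {m n : ℕ} {G : Type*} [Group G] [Fintype G]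
    (ρ : G →* ((Fin m → ℂ) ≃ₗ[ℂ] (Fin m → ℂ))) (σ : Fin n → MvPolynomial (Fin m) ℂ)
    (hgen : ∀ f : MvPolynomial (Fin m) ℂ,
      (∀ g x, MvPolynomial.eval (ρ g x) f = MvPolynomial.eval x f) →
      ∃ p : MvPolynomial (Fin n) ℂ, MvPolynomial.aeval σ p = f) (i : Fin m) :
    ∃ p : Fin (Fintype.card G) → MvPolynomial (Fin n) ℂ, ∀ x : Fin m → ℂ,
      (monicOfFn fun k => MvPolynomial.eval (fun j => MvPolynomial.eval x (σ j)) (p k)).IsRoot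
        (x i) := by
  let l : G → MvPolynomial (Fin m) ℂ := fun g =>
    ∑ j, MvPolynomial.C (ρ g (Pi.single j 1) i) * MvPolynomial.X j
  have hl : ∀ g x, MvPolynomial.eval x (l g) = ρ g x i := by
    intro g x
    conv_rhs => rw [← LinearEquiv.coe_coe, LinearMap.pi_apply_eq_sum_univ (ρ g).toLinearMap x]
    have hs : ∀ j : Fin m, (fun k => if j = k then (1 : ℂ) else 0) = Pi.single j 1 := fun j => by
      ext k; simp [Pi.single_apply, eq_comm]
    simp [l, hs, mul_comm]
  let F : Polynomial (MvPolynomial (Fin m) ℂ) := ∏ g, (X - C (l g))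
  have hF : ∀ x, F.map (MvPolynomial.eval x) = ∏ g, (X - C (ρ g x i)) := fun x => by
    simp [F, Polynomial.map_prod, hl]
  have hcoeff : ∀ k x, MvPolynomial.eval x (F.coeff k) = (∏ g, (X - C (ρ g x i))).coeff k :=
    fun k x => by rw [← hF, coeff_map]
  have hinv : ∀ k g x, MvPolynomial.eval (ρ g x) (F.coeff k) =
      MvPolynomial.eval x (F.coeff k) := by
    intro k g x
    rw [hcoeff, hcoeff]
    congr 1
    exact Fintype.prod_equiv (Equiv.mulRight g) _ _ fun h => by simp
  choose p hp using fun k : Fin (Fintype.card G) => hgen (F.coeff k) (hinv k)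
  refine ⟨p, fun x => ?_⟩
  have hpx : ∀ k, MvPolynomial.eval (fun j => MvPolynomial.eval x (σ j)) (p k) =
      (∏ g, (X - C (ρ g x i))).coeff k := by
    intro k
    rw [← hcoeff, ← hp k]
    simpa [MvPolynomial.aeval_eq_eval] using
      (MvPolynomial.comp_aeval_apply (f := σ) (MvPolynomial.aeval x) (p k)).symm
  simp only [hpx]
  rw [monicOfFn_coeff (monic_prod_of_monic _ _ fun g _ => monic_X_sub_C _)
    (by simp [natDegree_prod_of_monic, monic_X_sub_C])]
  simp only [IsRoot.def, eval_prod, eval_sub, eval_X, eval_C]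
  exact Finset.prod_eq_zero (Finset.mem_univ 1) (by simp)

/-- If near `0` the germ `c` lifts over an analytic map pointwise with all coordinates taken
from a finite list of analytic functions, then it has an analytic lift. -/
theorem exists_analyticAt_lift {m : ℕ} {F : Type*} [NormedAddCommGroup F] [NormedSpace ℝ F]
    {Φ : (Fin m → ℂ) → F} (hΦ : ∀ x, AnalyticAt ℝ Φ x) {c : ℝ → F} (hc : AnalyticAt ℝ c 0)
    {L : List (ℝ → ℂ)} (hL : ∀ r ∈ L, AnalyticAt ℝ r 0)
    (h : ∀ᶠ s in 𝓝 (0 : ℝ), ∃ x, Φ x = c s ∧ ∀ i, ∃ r ∈ L, x i = r s) :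
    ∃ f : ℝ → Fin m → ℂ, AnalyticAt ℝ f 0 ∧ ∀ᶠ s in 𝓝 (0 : ℝ), Φ (f s) = c s := by
  let f : (Fin m → Fin L.length) → ℝ → Fin m → ℂ := fun j s i => L[j i] s
  have hf : ∀ j, AnalyticAt ℝ (f j) 0 := fun j =>
    analyticAt_pi_iff.2 fun i => hL _ (List.getElem_mem _)
  have h1 : ∃ᶠ s in 𝓝[≠] (0 : ℝ), ∃ j, Φ (f j s) = c s := by
    refine (h.filter_mono nhdsWithin_le_nhds).frequently.mono ?_
    rintro s ⟨x, hx, hr⟩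
    have hr' : ∀ i, ∃ j : Fin L.length, x i = L[j] s := fun i => by
      obtain ⟨r, hrL, hxr⟩ := hr i
      obtain ⟨j, hj, rfl⟩ := List.mem_iff_getElem.1 hrL
      exact ⟨⟨j, hj⟩, hxr⟩
    choose j hj using hr'
    exact ⟨j, by rw [← hx, funext hj]⟩
  obtain ⟨j, hj⟩ : ∃ j, ∃ᶠ s in 𝓝[≠] (0 : ℝ), Φ (f j s) = c s := by
    by_contra! hcon
    exact h1 ((eventually_all.2 hcon).mono fun s hs ⟨j, hj⟩ => hs j hj)
  exact ⟨f j, hf j, (((hΦ _).fun_comp (hf j)).frequently_eq_iff_eventually_eq hc).1 hj⟩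

/-- Puiseux-type theorem (finite group, real-analytic case): after the substitution
`t ↦ t₀ ± (t - t₀)^N` a real-analytic curve in `σ(ℂ^m)` admits real-analytic lifts near `t₀`. -/
theorem stmt3
    {m n : ℕ} {G : Type} [Group G] [Fintype G]
    (ρ : G →* ((Fin m → ℂ) ≃ₗ[ℂ] (Fin m → ℂ)))
    (σ : Fin n → MvPolynomial (Fin m) ℂ) (deg : Fin n → ℕ)
    (hdeg : ∀ k, 1 ≤ deg k)
    (hhom : ∀ k, (σ k).IsHomogeneous (deg k))
    (hinv : ∀ k g x, MvPolynomial.eval (ρ g x) (σ k) = MvPolynomial.eval x (σ k))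
    (hgen : ∀ f : MvPolynomial (Fin m) ℂ,
      (∀ g x, MvPolynomial.eval (ρ g x) f = MvPolynomial.eval x f) →
      ∃ p : MvPolynomial (Fin n) ℂ, MvPolynomial.aeval σ p = f)
    (σm : (Fin m → ℂ) → (Fin n → ℂ))
    (hσm : ∀ x k, σm x k = MvPolynomial.eval x (σ k))
    (I : Set ℝ) (hIo : IsOpen I) (hIc : I.OrdConnected)
    (t₀ : ℝ) (ht₀ : t₀ ∈ I)
    (c : ℝ → Fin n → ℂ) (hc : AnalyticOnNhd ℝ c I)
    (hcσ : ∀ t ∈ I, ∃ x : Fin m → ℂ, σm x = c t) :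
    ∃ (N : ℕ) (δ : ℝ) (cp cq : ℝ → Fin m → ℂ), 0 < N ∧ 0 < δ ∧
      AnalyticOnNhd ℝ cp (Set.Ioo (t₀ - δ) (t₀ + δ)) ∧
      AnalyticOnNhd ℝ cq (Set.Ioo (t₀ - δ) (t₀ + δ)) ∧
      ∀ t ∈ Set.Ioo (t₀ - δ) (t₀ + δ),
        (t₀ + (t - t₀) ^ N ∈ I ∧ σm (cp t) = c (t₀ + (t - t₀) ^ N)) ∧
        (t₀ - (t - t₀) ^ N ∈ I ∧ σm (cq t) = c (t₀ - (t - t₀) ^ N)) := by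
  choose p hp using exists_isRoot_monicOfFn_of_invariants ρ σ hgen
  obtain rfl : σm = fun x k => MvPolynomial.eval x (σ k) := funext fun x => funext (hσm x)
  have hΦ : ∀ x, AnalyticAt ℝ (fun (x : Fin m → ℂ) k => MvPolynomial.eval x (σ k)) x :=
    fun x => analyticAt_pi_iff.2 fun k =>
      (AnalyticOnNhd.eval_mvPolynomial (σ k) x (mem_univ x)).restrictScalars
  let P : Fin m → ℝ → ℂ[X] := fun i t => monicOfFn fun k => MvPolynomial.eval (c (t₀ + t)) (p i k)
  have hP : ∀ (u : ℝ) i, PuiseuxSplits fun t => P i (u * t) := by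
    intro u i
    have hcu : AnalyticAt ℝ (fun t => c (t₀ + u * t)) 0 :=
      AnalyticAt.fun_comp (g := c) (f := fun t : ℝ => t₀ + u * t) (by simpa using hc t₀ ht₀)
        (by fun_prop)
    refine puiseuxSplits_of_analyticAt _ (fun _ => monic_monicOfFn _)
      (fun _ => natDegree_monicOfFn _) (analyticAt_coeff_monicOfFn (analyticAt_pi_iff.2 fun k => ?_))
    exact AnalyticAt.fun_comp (g := fun y => MvPolynomial.eval y (p i k))
      (AnalyticOnNhd.eval_mvPolynomial (p i k) _ (mem_univ _)).restrictScalars hcu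
  obtain ⟨N, L, hN, hL, hNL⟩ := PuiseuxSplits.prod Finset.univ fun i => (hP 1 i).mul (hP (-1) i)
  have hI : ∀ u : ℝ, ∀ᶠ s in 𝓝 (0 : ℝ), t₀ + u * s ^ N ∈ I := fun u => by
    have h : ContinuousAt (fun s : ℝ => t₀ + u * s ^ N) 0 := by fun_prop
    exact h.eventually_mem (by simpa [hN.ne'] using hIo.mem_nhds ht₀)
  have lift : ∀ u : ℝ, u = 1 ∨ u = -1 → ∃ f : ℝ → Fin m → ℂ, AnalyticAt ℝ f 0 ∧
      ∀ᶠ s in 𝓝 (0 : ℝ), (fun k => MvPolynomial.eval (f s) (σ k)) = c (t₀ + u * s ^ N) := by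
    intro u hu
    refine exists_analyticAt_lift hΦ ?_ hL ?_
    · exact AnalyticAt.fun_comp (g := c) (f := fun s : ℝ => t₀ + u * s ^ N)
        (by simpa [hN.ne'] using hc t₀ ht₀) (by fun_prop)
    · filter_upwards [hNL, hI u] with s hs hsI
      obtain ⟨x, hx⟩ := hcσ _ hsI
      refine ⟨x, hx, fun i => ?_⟩
      have hroot : (P i (u * s ^ N)).eval (x i) = 0 := by
        simp only [P, ← hx]
        exact hp i x
      have h0 := congr_arg (eval (x i)) hs
      rw [eval_prod, Finset.prod_eq_zero (Finset.mem_univ i) (by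
        rcases hu with rfl | rfl <;> rw [eval_mul, hroot] <;> simp)] at h0
      rw [eval_list_prod, eq_comm, List.prod_eq_zero_iff] at h0
      simpa [sub_eq_zero] using h0
  obtain ⟨f, hf, hfe⟩ := lift 1 (.inl rfl)
  obtain ⟨g, hg, hge⟩ := lift (-1) (.inr rfl)
  obtain ⟨δ, hδ, hball⟩ := Metric.eventually_nhds_iff_ball.1
    ((hf.eventually_analyticAt.and hg.eventually_analyticAt).and
      ((hfe.and hge).and ((hI 1).and (hI (-1)))))
  have hmem : ∀ t ∈ Set.Ioo (t₀ - δ) (t₀ + δ), t - t₀ ∈ Metric.ball (0 : ℝ) δ := by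
    intro t ht
    rw [mem_ball_zero_iff, Real.norm_eq_abs, abs_lt]
    constructor <;> linarith [ht.1, ht.2]
  refine ⟨N, δ, fun t => f (t - t₀), fun t => g (t - t₀), hN, hδ, fun t ht => ?_, fun t ht => ?_,
    fun t ht => ?_⟩
  · exact AnalyticAt.fun_comp (g := f) (f := fun t => t - t₀) (hball _ (hmem t ht)).1.1 (by fun_prop)
  · exact AnalyticAt.fun_comp (g := g) (f := fun t => t - t₀) (hball _ (hmem t ht)).1.2 (by fun_prop)
  · obtain ⟨-, ⟨h1, h2⟩, h3, h4⟩ := hball _ (hmem t ht)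
    rw [one_mul] at h1 h3
    rw [neg_one_mul, ← sub_eq_add_neg] at h2 h4
    exact ⟨⟨h3, h1⟩, h4, h2⟩
end

section
/- Let I ⊆ ℝ be an open interval and let c : I → ℂ^n be a real-analytic curve with c(t) ∈ σ(ℂ^m) for all t ∈ I. Then there exists a continuous lift c̄ : I → ℂ^m of c (σ ∘ c̄ = c) which is locally absolutely continuous, i.e., absolutely continuous on every compact subinterval of I. -/
open MeasureTheory Set Filter

open scoped Topology

namespace PathLifting

section Orbit

variable {G X : Type*} [Group G] [TopologicalSpace X] [MulAction G X]

/-- `f` is continuous on `S` and stays in the `H`-orbits prescribed by `q`. -/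
def OrbitLift (H : Subgroup G) (q : ℝ → X) (S : Set ℝ) (f : ℝ → X) : Prop :=
  ContinuousOn f S ∧ ∀ t ∈ S, ∃ h ∈ H, f t = h • q t

/-- The path of `H`-orbits represented by `q` is continuous at every point of `J`. -/
def OrbitContinuousOn (H : Subgroup G) (q : ℝ → X) (J : Set ℝ) : Prop :=
  ∀ t₀ ∈ J, ∀ U ∈ 𝓝 (q t₀), ∀ᶠ t in 𝓝 t₀, ∃ h ∈ H, h • q t ∈ U

variable {H : Subgroup G} {q : ℝ → X} {S T J : Set ℝ} {f g : ℝ → X}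

lemma OrbitLift.mono (hf : OrbitLift H q S f) (hT : T ⊆ S) : OrbitLift H q T f :=
  ⟨hf.1.mono hT, fun t ht => hf.2 t (hT ht)⟩

lemma OrbitLift.congr (hf : OrbitLift H q S f) (hg : EqOn g f S) : OrbitLift H q S g :=
  ⟨hf.1.congr hg, fun t ht => by rw [hg ht]; exact hf.2 t ht⟩

lemma OrbitLift.exists_union [ContinuousConstSMul G X] (hf : OrbitLift H q S f)
    (hg : OrbitLift H q T g) (hS : IsClosed S) (hT : IsClosed T) {b : ℝ} (hbS : b ∈ S)
    (hbT : b ∈ T) (hST : S ∩ T ⊆ {b}) :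
    ∃ F, OrbitLift H q (S ∪ T) F ∧ EqOn F f S := by
  classical
  obtain ⟨h₁, hh₁, e₁⟩ := hf.2 b hbS
  obtain ⟨h₂, hh₂, e₂⟩ := hg.2 b hbT
  have hk : h₁ * h₂⁻¹ ∈ H := H.mul_mem hh₁ (H.inv_mem hh₂)
  have eS : EqOn (S.piecewise f fun t => (h₁ * h₂⁻¹) • g t) f S := piecewise_eqOn _ _ _
  have eT : EqOn (S.piecewise f fun t => (h₁ * h₂⁻¹) • g t) (fun t => (h₁ * h₂⁻¹) • g t) T := by
    intro t ht
    by_cases hs : t ∈ S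
    · obtain rfl : t = b := hST ⟨hs, ht⟩
      simp [hs, e₁, e₂, mul_smul]
    · simp [hs]
  have hg' : OrbitLift H q T (fun t => (h₁ * h₂⁻¹) • g t) := by
    refine ⟨hg.1.const_smul _, fun t ht => ?_⟩
    obtain ⟨h, hh, e⟩ := hg.2 t ht
    exact ⟨_, H.mul_mem hk hh, by simp only [e, mul_smul]⟩
  refine ⟨_, ⟨(hf.congr eS).1.union_of_isClosed (hg'.congr eT).1 hS hT, ?_⟩, eS⟩
  rintro t (ht | ht)
  exacts [(hf.congr eS).2 t ht, (hg'.congr eT).2 t ht]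

lemma exists_orbitLift_Icc_append [ContinuousConstSMul G X] {a b c : ℝ} (hab : a ≤ b)
    (hbc : b ≤ c) (hf : OrbitLift H q (Icc a b) f) (hg : OrbitLift H q (Icc b c) g) :
    ∃ F, OrbitLift H q (Icc a c) F ∧ EqOn F f (Icc a b) := by
  have := hf.exists_union hg isClosed_Icc isClosed_Icc (right_mem_Icc.2 hab)
    (left_mem_Icc.2 hbc) (fun t ht => le_antisymm ht.1.2 ht.2.1)
  rwa [Icc_union_Icc_eq_Icc hab hbc] at this

lemma exists_orbitLift_Icc_prepend [ContinuousConstSMul G X] {a b c : ℝ} (hab : a ≤ b)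
    (hbc : b ≤ c) (hf : OrbitLift H q (Icc a b) f) (hg : OrbitLift H q (Icc b c) g) :
    ∃ F, OrbitLift H q (Icc a c) F ∧ EqOn F g (Icc b c) := by
  have := hg.exists_union hf isClosed_Icc isClosed_Icc (left_mem_Icc.2 hbc)
    (right_mem_Icc.2 hab) (fun t ht => le_antisymm ht.2.2 ht.1.1)
  rwa [union_comm, Icc_union_Icc_eq_Icc hab hbc] at this

lemma exists_orbitLift_uIcc [ContinuousConstSMul G X] (hJ : J.OrdConnected)
    (hloc : ∀ t ∈ J, ∃ U ∈ 𝓝 t, ∃ f, OrbitLift H q U f) {a b : ℝ} (ha : a ∈ J) (hb : b ∈ J) :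
    ∃ f, OrbitLift H q (uIcc a b) f := by
  refine hJ.isPreconnected.induction₂ (fun x y => ∃ f, OrbitLift H q (uIcc x y) f) ?_ ?_ ?_ ha hb
  · intro x hx
    obtain ⟨U, hU, f, hf⟩ := hloc x hx
    obtain ⟨ε, hε, hball⟩ := Metric.mem_nhds_iff.1 hU
    filter_upwards [nhdsWithin_le_nhds (Metric.ball_mem_nhds x hε)] with y hy
    refine ⟨f, hf.mono (Subset.trans ?_ hball)⟩
    have := (convex_ball x ε).ordConnected
    exact this.uIcc_subset (Metric.mem_ball_self hε) hy
  · rintro x y z - - - ⟨f, hf⟩ ⟨g, hg⟩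
    wlog hxz : x ≤ z generalizing x z f g
    · rw [uIcc_comm x z]
      rw [uIcc_comm] at hf hg
      exact this z x g hg f hf (le_of_not_ge hxz)
    rcases le_total y x with hyx | hxy
    · refine ⟨g, hg.mono ?_⟩
      rw [uIcc_of_le hxz, uIcc_of_le (hyx.trans hxz)]
      exact Icc_subset_Icc_left hyx
    rcases le_total z y with hzy | hyz
    · refine ⟨f, hf.mono ?_⟩
      rw [uIcc_of_le hxz, uIcc_of_le hxy]
      exact Icc_subset_Icc_right hzy
    rw [uIcc_of_le hxz]
    rw [uIcc_of_le hxy] at hf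
    rw [uIcc_of_le hyz] at hg
    obtain ⟨F, hF, -⟩ := exists_orbitLift_Icc_append hxy hyz hf hg
    exact ⟨F, hF⟩
  · rintro x y - - h
    rwa [uIcc_comm]

lemma exists_orbitLift_Icc_extend [ContinuousConstSMul G X] (hJ : J.OrdConnected)
    (hloc : ∀ t ∈ J, ∃ U ∈ 𝓝 t, ∃ f, OrbitLift H q U f) {a b r : ℝ} (hab : a ≤ b)
    (hsub : Icc a b ⊆ J) (hr : r ∈ J) (hf : OrbitLift H q (Icc a b) f) :
    ∃ F, OrbitLift H q (Icc (min a r) (max b r)) F ∧ EqOn F f (Icc a b) := by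
  have haJ := hsub (left_mem_Icc.2 hab)
  have hbJ := hsub (right_mem_Icc.2 hab)
  rcases le_total r a with hra | har
  · obtain ⟨g, hg⟩ := exists_orbitLift_uIcc hJ hloc hr haJ
    rw [uIcc_of_le hra] at hg
    rw [min_eq_right hra, max_eq_left (hra.trans hab)]
    exact exists_orbitLift_Icc_prepend hra hab hg hf
  rw [min_eq_left har]
  rcases le_total r b with hrb | hbr
  · rw [max_eq_left hrb]
    exact ⟨f, hf, fun _ _ => rfl⟩
  · obtain ⟨g, hg⟩ := exists_orbitLift_uIcc hJ hloc hbJ hr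
    rw [uIcc_of_le hbr] at hg
    rw [max_eq_right hbr]
    exact exists_orbitLift_Icc_append hab hbr hf hg

lemma exists_orbitLift_of_ordConnected [ContinuousConstSMul G X] (hJ : J.OrdConnected)
    (hJo : IsOpen J) (hloc : ∀ t ∈ J, ∃ U ∈ 𝓝 t, ∃ f, OrbitLift H q U f) :
    ∃ f, OrbitLift H q J f := by
  classical
  rcases J.eq_empty_or_nonempty with rfl | ⟨t₀, ht₀⟩
  · exact ⟨q, by simp [OrbitLift]⟩
  have : Nonempty J := ⟨⟨t₀, ht₀⟩⟩
  let r : ℕ → J := TopologicalSpace.denseSeq J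
  let P : Type _ := {p : ℝ × ℝ × (ℝ → X) //
    p.1 ≤ p.2.1 ∧ Icc p.1 p.2.1 ⊆ J ∧ OrbitLift H q (Icc p.1 p.2.1) p.2.2}
  have hstep : ∀ (p : P) (r : J), ∃ p' : P, p'.1.1 = min p.1.1 r ∧ p'.1.2.1 = max p.1.2.1 r ∧
      EqOn p'.1.2.2 p.1.2.2 (Icc p.1.1 p.1.2.1) := by
    rintro ⟨⟨a, b, f⟩, hab, hsub, hf⟩ ⟨r, hr⟩
    obtain ⟨F, hF, e⟩ := exists_orbitLift_Icc_extend hJ hloc hab hsub hr hf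
    have haJ := hsub (left_mem_Icc.2 hab)
    have hbJ := hsub (right_mem_Icc.2 hab)
    refine ⟨⟨⟨min a r, max b r, F⟩, (min_le_left _ _).trans (hab.trans (le_max_left _ _)),
      hJ.out ?_ ?_, hF⟩, rfl, rfl, e⟩
    · rcases min_choice a r with h | h <;> rw [h] <;> assumption
    · rcases max_choice b r with h | h <;> rw [h] <;> assumption
  choose next hn₁ hn₂ hn₃ using hstep
  let p₀ : P := ⟨⟨t₀, t₀, q⟩, le_rfl, by simpa using ht₀, by
    simp, fun t _ => ⟨1, H.one_mem, by simp⟩⟩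
  let p : ℕ → P := fun n => Nat.rec p₀ (fun n x => next x (r n)) n
  have hp : ∀ n, p (n + 1) = next (p n) (r n) := fun n => rfl
  let K : ℕ → Set ℝ := fun n => Icc (p n).1.1 (p n).1.2.1
  have hK : Monotone K := by
    refine monotone_nat_of_le_succ fun n => Icc_subset_Icc ?_ ?_
    · rw [hp, hn₁]; exact min_le_left _ _
    · rw [hp, hn₂]; exact le_max_left _ _
  have hr₁ : ∀ n, (p (n + 1)).1.1 ≤ r n := fun n => by rw [hp, hn₁]; exact min_le_right _ _
  have hr₂ : ∀ n, (r n : ℝ) ≤ (p (n + 1)).1.2.1 := fun n => by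
    rw [hp, hn₂]; exact le_max_right _ _
  have hEq : ∀ m n, m ≤ n → EqOn (p n).1.2.2 (p m).1.2.2 (K m) := by
    intro m n hmn
    induction n, hmn using Nat.le_induction with
    | base => exact fun _ _ => rfl
    | succ n hmn ih =>
      intro t ht
      rw [← ih ht, hp]
      exact hn₃ _ _ (hK hmn ht)
  have hnhds : ∀ t ∈ J, ∃ n, K n ∈ 𝓝 t := by
    intro t ht
    obtain ⟨ε, hε, hball⟩ := Metric.isOpen_iff.1 hJo t ht
    have key : ∀ c d : ℝ, c < d → Ioo c d ⊆ J → ∃ n, (r n : ℝ) ∈ Ioo c d := by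
      intro c d hcd hsub
      have ho : IsOpen ((↑) ⁻¹' Ioo c d : Set J) := isOpen_Ioo.preimage continuous_subtype_val
      obtain ⟨x, hx⟩ := nonempty_Ioo.2 hcd
      obtain ⟨y, hy, n, rfl⟩ := (TopologicalSpace.denseRange_denseSeq J).inter_open_nonempty _ ho
        ⟨⟨x, hsub hx⟩, hx⟩
      exact ⟨n, hy⟩
    rw [Real.ball_eq_Ioo] at hball
    obtain ⟨i, hi⟩ := key (t - ε) t (by linarith)
      (fun x hx => hball ⟨hx.1, by linarith [hx.2]⟩)
    obtain ⟨j, hj⟩ := key t (t + ε) (by linarith)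
      (fun x hx => hball ⟨by linarith [hx.1], hx.2⟩)
    refine ⟨max (i + 1) (j + 1), mem_of_superset (Icc_mem_nhds hi.2 hj.1) ?_⟩
    have h₁ : (r i : ℝ) ∈ K (i + 1) :=
      ⟨hr₁ i, by rw [hp, hn₂]; exact le_max_right _ _⟩
    have h₂ : (r j : ℝ) ∈ K (j + 1) :=
      ⟨hr₁ j, by rw [hp, hn₂]; exact le_max_right _ _⟩
    exact Icc_subset_Icc (hK (le_max_left _ _) h₁).1 (hK (le_max_right _ _) h₂).2
  choose! k hk using hnhds
  have hL : ∀ n, EqOn (fun t => (p (k t)).1.2.2 t) (p n).1.2.2 (K n ∩ J) := by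
    rintro n t ⟨htn, htJ⟩
    rcases le_total (k t) n with h | h
    · exact (hEq _ _ h (mem_of_mem_nhds (hk t htJ))).symm
    · exact hEq _ _ h htn
  refine ⟨fun t => (p (k t)).1.2.2 t, fun t ht => ContinuousAt.continuousWithinAt ?_, fun t ht => ?_⟩
  · refine ((p (k t)).2.2.2.1.continuousAt (hk t ht)).congr ?_
    filter_upwards [hk t ht, hJo.mem_nhds ht] with s hs hsJ
    exact (hL (k t) ⟨hs, hsJ⟩).symm
  · exact (p (k t)).2.2.2.2 t (mem_of_mem_nhds (hk t ht))

lemma exists_orbitLift_of_local [ContinuousConstSMul G X] {s : Set ℝ}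
    (hs : IsOpen s) (hloc : ∀ t ∈ s, ∃ U ∈ 𝓝 t, ∃ f, OrbitLift H q U f) :
    ∃ f, OrbitLift H q s f := by
  classical
  have hcomp : ∀ x, ∃ f, OrbitLift H q (ordConnectedComponent s x) f := by
    intro x
    refine exists_orbitLift_of_ordConnected inferInstance ?_
      (fun t ht => hloc t (ordConnectedComponent_subset ht))
    rw [isOpen_iff_mem_nhds]
    intro y hy
    rw [ordConnectedComponent_eq hy]
    exact ordConnectedComponent_mem_nhds.2 (hs.mem_nhds (ordConnectedComponent_subset hy))
  choose L hL using hcomp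
  let F : ℝ → X := fun t => if h : t ∈ s then L (ordConnectedProj s ⟨t, h⟩) t else q t
  refine ⟨F, fun t ht => ContinuousAt.continuousWithinAt ?_, fun t ht => ?_⟩
  · have hmem : ordConnectedComponent s t ∈ 𝓝 t :=
      ordConnectedComponent_mem_nhds.2 (hs.mem_nhds ht)
    have hc : ContinuousAt (L (ordConnectedProj s ⟨t, ht⟩)) t := by
      refine (hL _).1.continuousAt ?_
      rw [ordConnectedComponent_ordConnectedProj]
      exact hmem
    refine hc.congr ?_
    filter_upwards [hmem] with u hu
    have hus : u ∈ s := ordConnectedComponent_subset hu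
    have : ordConnectedProj s ⟨u, hus⟩ = ordConnectedProj s ⟨t, ht⟩ := by
      rw [ordConnectedProj_eq, uIcc_comm]
      exact hu
    simp only [F, hus, dif_pos, this]
  · simp only [F, ht, dif_pos]
    exact (hL _).2 t (mem_ordConnectedComponent_ordConnectedProj s ⟨t, ht⟩)

lemma exists_nhds_forall_smul_notMem [ContinuousConstSMul G X] [T2Space X] [Finite G] (x : X) :
    ∃ U ∈ 𝓝 x, ∀ g : G, g • x ≠ x → ∀ y ∈ U, g • y ∉ U := by
  have h : ∀ g : G, ∃ U ∈ 𝓝 x, g • x ≠ x → ∀ y ∈ U, g • y ∉ U := by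
    intro g
    by_cases hg : g • x = x
    · exact ⟨univ, univ_mem, fun h => (h hg).elim⟩
    obtain ⟨V, W, hV, hW, hxV, hxW, hd⟩ := t2_separation hg
    refine ⟨W ∩ (fun y => g • y) ⁻¹' V, inter_mem (hW.mem_nhds hxW)
      ((continuous_const_smul g).continuousAt.preimage_mem_nhds (hV.mem_nhds hxV)), ?_⟩
    rintro - y ⟨-, hy⟩ ⟨hy', -⟩
    exact hd.le_bot ⟨hy, hy'⟩
  choose U hU hU' using h
  exact ⟨⋂ g, U g, iInter_mem.2 hU, fun g hg y hy hy' =>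
    hU' g hg y (mem_iInter.1 hy g) (mem_iInter.1 hy' g)⟩

/-- A continuous path of orbits of a finite group over an open set of reals lifts. -/
theorem OrbitContinuousOn.exists_orbitLift [ContinuousConstSMul G X] [T2Space X] [Finite G]
    (H : Subgroup G) (q : ℝ → X) (J : Set ℝ) (hJ : IsOpen J) (hq : OrbitContinuousOn H q J) :
    ∃ f, OrbitLift H q J f := by
  classical
  induction H using WellFoundedLT.induction generalizing q J with
  | ind H ih =>
  let s : Set ℝ := {t | t ∈ J ∧ ∃ h ∈ H, h • q t ≠ q t}
  have hloc : ∀ t₀ ∈ s, ∃ V, IsOpen V ∧ t₀ ∈ V ∧ V ⊆ s ∧ ∃ f, OrbitLift H q V f := by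
    rintro t₀ ⟨ht₀, h₀, hh₀, hne⟩
    obtain ⟨U', hU', hsep'⟩ := exists_nhds_forall_smul_notMem (G := G) (q t₀)
    obtain ⟨U, hUU', hUo, hU⟩ := mem_nhds_iff.1 hU'
    have hsep : ∀ g : G, g • q t₀ ≠ q t₀ → ∀ y ∈ U, g • y ∉ U :=
      fun g hg y hy hy' => hsep' g hg y (hUU' hy) (hUU' hy')
    obtain ⟨V, hV, hVo, htV⟩ := eventually_nhds_iff.1
      ((hq t₀ ht₀ U (hUo.mem_nhds hU)).and (hJ.mem_nhds ht₀))
    have hVJ : V ⊆ J := fun t ht => (hV t ht).2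
    have hV' : ∀ t ∈ V, ∃ h ∈ H, h • q t ∈ U := fun t ht => (hV t ht).1
    choose! k hkH hkU using hV'
    refine ⟨V, hVo, htV, ?_, ?_⟩
    · intro t ht
      refine ⟨hVJ ht, ?_⟩
      by_contra! hfix
      refine hsep h₀ hne _ (hkU t ht) ?_
      rw [hfix _ (hkH t ht), hfix _ hh₀]
      simpa [hfix _ (hkH t ht)] using hkU t ht
    · let K : Subgroup G := H ⊓ MulAction.stabilizer G (q t₀)
      have hKH : K < H := by
        refine lt_of_le_of_ne inf_le_left fun e => hne ?_
        have : h₀ ∈ K := by rw [e]; exact hh₀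
        exact this.2
      have hqK : OrbitContinuousOn K (fun t => k t • q t) V := by
        intro t₁ ht₁ W hW
        have hW' : (fun y => k t₁ • y) ⁻¹' (W ∩ U) ∈ 𝓝 (q t₁) :=
          (continuous_const_smul (k t₁)).continuousAt.preimage_mem_nhds
            (inter_mem hW (hUo.mem_nhds (hkU t₁ ht₁)))
        filter_upwards [hq t₁ (hVJ ht₁) _ hW', hVo.mem_nhds ht₁] with t ⟨h, hh, hmem⟩ htV
        have e : (k t₁ * h * (k t)⁻¹) • (k t • q t) = k t₁ • (h • q t) := by
          simp [mul_smul]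
        refine ⟨k t₁ * h * (k t)⁻¹, ⟨?_, ?_⟩, ?_⟩
        · exact H.mul_mem (H.mul_mem (hkH _ ht₁) hh) (H.inv_mem (hkH _ htV))
        · by_contra hns
          refine hsep _ hns _ (hkU t htV) ?_
          rw [e]
          exact hmem.2
        · rw [e]
          exact hmem.1
      obtain ⟨f, hf⟩ := ih K hKH _ V hVo hqK
      refine ⟨f, hf.1, fun t ht => ?_⟩
      obtain ⟨h, hh, e⟩ := hf.2 t ht
      exact ⟨h * k t, H.mul_mem hh.1 (hkH t ht), by rw [e, mul_smul]⟩
  have hs : IsOpen s := isOpen_iff_mem_nhds.2 fun t ht => by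
    obtain ⟨V, hVo, htV, hVs, -⟩ := hloc t ht
    exact mem_of_superset (hVo.mem_nhds htV) hVs
  obtain ⟨f, hf⟩ := exists_orbitLift_of_local (H := H) (q := q) hs fun t ht => by
    obtain ⟨V, hVo, htV, -, hf⟩ := hloc t ht
    exact ⟨V, hVo.mem_nhds htV, hf⟩
  have hF : ∀ t, ∃ h ∈ H, s.piecewise f q t = h • q t := by
    intro t
    by_cases ht : t ∈ s
    · simpa [ht] using hf.2 t ht
    · exact ⟨1, H.one_mem, by simp [ht]⟩
  refine ⟨s.piecewise f q, fun t₀ ht₀ => ContinuousAt.continuousWithinAt ?_, fun t _ => hF t⟩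
  by_cases hts : t₀ ∈ s
  · refine (hf.1.continuousAt (hs.mem_nhds hts)).congr ?_
    filter_upwards [hs.mem_nhds hts] with t ht
    simp [ht]
  · have hfix : ∀ h ∈ H, h • q t₀ = q t₀ := by
      intro h hh
      by_contra hne
      exact hts ⟨ht₀, h, hh, hne⟩
    rw [ContinuousAt, piecewise_eq_of_notMem _ _ _ hts]
    intro U hU
    have hU' : (⋂ h : H, (fun y : X => (h : G) • y) ⁻¹' U) ∈ 𝓝 (q t₀) := by
      refine iInter_mem.2 fun h => (continuous_const_smul (h : G)).continuousAt.preimage_mem_nhds ?_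
      rwa [hfix h h.2]
    rw [mem_map]
    filter_upwards [hq t₀ ht₀ _ hU'] with t ⟨h, hh, hmem⟩
    obtain ⟨h', hh', e⟩ := hF t
    have := mem_iInter.1 hmem ⟨h' * h⁻¹, H.mul_mem hh' (H.inv_mem hh)⟩
    simpa [e, mul_smul] using this

end Orbit

end PathLifting
namespace AlgebraicGerm

open Polynomial

section Pointwise

/-- The implicit derivative of a continuous root of a polynomial with differentiable
coefficients, at a point where the root is simple. -/
lemma hasDerivAt_of_root {a : ℕ → ℝ → ℂ} {N : ℕ} {y : ℝ → ℂ} {t : ℝ}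
    (ha : ∀ k ∈ Finset.range N, DifferentiableAt ℝ (a k) t) (hy : ContinuousAt y t)
    (hroot : ∀ᶠ s in 𝓝 t, ∑ k ∈ Finset.range N, a k s * y s ^ k = 0)
    (hne : ∑ k ∈ Finset.range N, a k t * (k * y t ^ (k - 1)) ≠ 0) :
    HasDerivAt y (-(∑ k ∈ Finset.range N, deriv (a k) t * y t ^ k) /
      ∑ k ∈ Finset.range N, a k t * (k * y t ^ (k - 1))) t := by
  set g : ℝ → ℂ := fun s => ∑ k ∈ Finset.range N, a k s * y t ^ k with hg
  set h : ℝ → ℂ := fun s => ∑ k ∈ Finset.range N,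
    a k s * ∑ i ∈ Finset.range k, y s ^ i * y t ^ (k - 1 - i) with hh
  have hgd : HasDerivAt g (∑ k ∈ Finset.range N, deriv (a k) t * y t ^ k) t :=
    HasDerivAt.fun_sum fun k hk => (ha k hk).hasDerivAt.mul_const _
  have hht : h t = ∑ k ∈ Finset.range N, a k t * (k * y t ^ (k - 1)) := by
    refine Finset.sum_congr rfl fun k _ => ?_
    congr 1
    rw [Finset.sum_congr rfl (g := fun _ => y t ^ (k - 1))]
    · simp
    · intro i hi
      rw [← pow_add]
      congr 1
      have := Finset.mem_range.1 hi
      lia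
  have hhc : ContinuousAt h t := by
    exact tendsto_finsetSum _ fun k hk => (ha k hk).continuousAt.tendsto.mul
      (tendsto_finsetSum _ fun i _ => (hy.pow i).mul continuousAt_const)
  have key : ∀ s, h s * (y s - y t) = ∑ k ∈ Finset.range N, a k s * y s ^ k - g s := by
    intro s
    simp only [hh, hg, Finset.sum_mul, ← Finset.sum_sub_distrib]
    refine Finset.sum_congr rfl fun k _ => ?_
    rw [mul_assoc, (Commute.all _ _).geom_sum₂_mul, mul_sub]
  have hg0 : g t = 0 := hroot.self_of_nhds
  have hhne : h t ≠ 0 := by rwa [hht]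
  rw [← hht, hasDerivAt_iff_tendsto_slope]
  rw [hasDerivAt_iff_tendsto_slope] at hgd
  refine (hgd.neg.div (hhc.tendsto.mono_left nhdsWithin_le_nhds) hhne).congr' ?_
  filter_upwards [nhdsWithin_le_nhds hroot, nhdsWithin_le_nhds (hhc.eventually_ne hhne)]
    with s hs hsne
  have := key s
  rw [hs, zero_sub] at this
  simp only [slope_def_module, hg0, sub_zero, Pi.div_apply]
  rw [div_eq_iff hsne, smul_mul_assoc, mul_comm (y s - y t), this, smul_neg]

lemma integrableOn_of_hasDerivAt_of_ne {u v : ℝ → ℝ} {a b : ℝ}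
    (hu : ContinuousOn u (Icc a b)) (hd : ∀ t ∈ Ioo a b, HasDerivAt u (v t) t)
    (hv : (∀ t ∈ Ioo a b, v t = 0) ∨ ∀ t ∈ Ioo a b, v t ≠ 0) : IntegrableOn v (Ioo a b) := by
  rcases hv with hv | hv
  · exact integrableOn_zero.congr_fun (fun t ht => (hv t ht).symm) measurableSet_Ioo
  rcases hasDerivWithinAt_forall_lt_or_forall_gt_of_forall_ne (convex_Ioo a b)
    (fun t ht => (hd t ht).hasDerivWithinAt) hv with h | h
  · have := intervalIntegral.integrableOn_deriv_of_nonneg hu.neg (fun t ht => (hd t ht).neg)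
      (fun t ht => by simpa using (h t ht).le)
    simpa using (this.mono_set Ioo_subset_Ioc_self).neg
  · exact (intervalIntegral.integrableOn_deriv_of_nonneg hu hd
      fun t ht => (h t ht).le).mono_set Ioo_subset_Ioc_self

end Pointwise

/-- An element integral over a perfect field is von Neumann regular in a reduced ring. -/
lemma exists_mul_mul_aeval_eq {K R : Type*} [Field K] [PerfectField K] [CommRing R] [IsReduced R]
    [Algebra K R] {w : R} (hw : IsIntegral K w) : ∃ P : K[X], w * (w * aeval w P) = w := by
  have hsep : (minpoly K w).Separable :=
    PerfectField.separable_iff_squarefree.2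
      ((minpoly.isRadical K w).squarefree (minpoly.ne_zero hw))
  have hroot := minpoly.aeval K w
  set Q := minpoly K w
  obtain ⟨A, B, hAB⟩ := hsep
  have hQ : X * Q.divX + C (Q.coeff 0) = Q := X_mul_divX_add Q
  have h₁ : w * aeval w Q.divX + algebraMap K R (Q.coeff 0) = 0 := by
    rw [← hroot]
    simpa only [map_add, map_mul, aeval_X, aeval_C] using congrArg (aeval w) hQ
  by_cases h0 : Q.coeff 0 = 0
  · set S := Q.divX
    have hS0 : S.coeff 0 ≠ 0 := by
      intro hS
      rw [h0, C_0, add_zero] at hQ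
      have := congrArg (eval 0) hAB
      simp [← hQ, ← coeff_zero_eq_eval_zero, hS] at this
    have hS : w * aeval w S.divX + algebraMap K R (S.coeff 0) = aeval w S := by
      simpa only [map_add, map_mul, aeval_X, aeval_C] using congrArg (aeval w) (X_mul_divX_add S)
    have h₂ : w * (w * aeval w S.divX + algebraMap K R (S.coeff 0)) = 0 := by
      rw [hS, ← h₁, h0, map_zero, add_zero]
    refine ⟨-C (S.coeff 0)⁻¹ * S.divX, ?_⟩
    have h₃ : algebraMap K R (S.coeff 0) * algebraMap K R (S.coeff 0)⁻¹ = 1 := by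
      rw [← map_mul, mul_inv_cancel₀ hS0, map_one]
    simp only [map_mul, map_neg, aeval_C]
    linear_combination (-algebraMap K R (S.coeff 0)⁻¹) * h₂ + w * h₃
  · refine ⟨-C (Q.coeff 0)⁻¹ * Q.divX, ?_⟩
    have h₃ : algebraMap K R (Q.coeff 0) * algebraMap K R (Q.coeff 0)⁻¹ = 1 := by
      rw [← map_mul, mul_inv_cancel₀ h0, map_one]
    simp only [map_mul, map_neg, aeval_C]
    linear_combination (-algebraMap K R (Q.coeff 0)⁻¹ * w) * h₁ + w * h₃

instance instIsReducedGerm {α : Type*} (l : Filter α) : IsReduced (Germ l ℂ) where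
  eq_zero φ := by
    rintro ⟨n, hn⟩
    induction φ using Germ.inductionOn with
    | _ f =>
    rw [← Germ.coe_pow, ← Germ.coe_zero, Germ.coe_eq] at hn
    rw [← Germ.coe_zero, Germ.coe_eq]
    filter_upwards [hn] with t ht
    exact eq_zero_of_pow_eq_zero ht

variable (t₀ : ℝ)

/-- Right germs at `t₀` of functions meromorphic at `t₀`. -/
def meroGerm : Subring (Germ (𝓝[>] t₀) ℂ) where
  carrier := {φ | ∃ f : ℝ → ℂ, MeromorphicAt f t₀ ∧ (f : Germ (𝓝[>] t₀) ℂ) = φ}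
  mul_mem' := by
    rintro _ _ ⟨f, hf, rfl⟩ ⟨g, hg, rfl⟩
    exact ⟨f * g, hf.mul hg, rfl⟩
  one_mem' := ⟨fun _ => 1, .const _ _, rfl⟩
  add_mem' := by
    rintro _ _ ⟨f, hf, rfl⟩ ⟨g, hg, rfl⟩
    exact ⟨f + g, hf.add hg, rfl⟩
  zero_mem' := ⟨fun _ => 0, .const _ _, rfl⟩
  neg_mem' := by
    rintro _ ⟨f, hf, rfl⟩
    exact ⟨-f, hf.neg, rfl⟩

/-- Right germs at `t₀` of functions continuous to the right of `t₀`. -/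
def contGerm : Subring (Germ (𝓝[>] t₀) ℂ) where
  carrier := {φ | ∃ f : ℝ → ℂ, (∀ᶠ t in 𝓝[>] t₀, ContinuousAt f t) ∧
    (f : Germ (𝓝[>] t₀) ℂ) = φ}
  mul_mem' := by
    rintro _ _ ⟨f, hf, rfl⟩ ⟨g, hg, rfl⟩
    exact ⟨f * g, by filter_upwards [hf, hg] with t h₁ h₂ using h₁.mul h₂, rfl⟩
  one_mem' := ⟨fun _ => 1, .of_forall fun _ => continuousAt_const, rfl⟩
  add_mem' := by
    rintro _ _ ⟨f, hf, rfl⟩ ⟨g, hg, rfl⟩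
    exact ⟨f + g, by filter_upwards [hf, hg] with t h₁ h₂ using h₁.add h₂, rfl⟩
  zero_mem' := ⟨fun _ => 0, .of_forall fun _ => continuousAt_const, rfl⟩
  neg_mem' := by
    rintro _ ⟨f, hf, rfl⟩
    exact ⟨-f, by filter_upwards [hf] with t h₁ using h₁.neg, rfl⟩

lemma nhdsGT_le_nhdsNE : 𝓝[>] t₀ ≤ 𝓝[≠] t₀ :=
  nhdsWithin_mono _ fun _ ht => ne_of_gt ht

lemma meroGerm_le_contGerm : meroGerm t₀ ≤ contGerm t₀ := by
  rintro _ ⟨f, hf, rfl⟩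
  exact ⟨f, nhdsGT_le_nhdsNE t₀ hf.eventually_continuousAt, rfl⟩

lemma isField_meroGerm : IsField (meroGerm t₀) where
  exists_pair_ne := ⟨0, 1, fun h => by
    have h' : (0 : Germ (𝓝[>] t₀) ℂ) = 1 := congrArg Subtype.val h
    exact zero_ne_one h'⟩
  mul_comm := mul_comm
  mul_inv_cancel := by
    rintro ⟨_, f, hf, rfl⟩ hne
    rcases hf.eventually_eq_zero_or_eventually_ne_zero with h | h
    · refine (hne (Subtype.ext ?_)).elim
      exact Germ.coe_eq.2 (nhdsGT_le_nhdsNE t₀ h)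
    · refine ⟨⟨_, f⁻¹, hf.inv, rfl⟩, Subtype.ext (Germ.coe_eq.2 ?_)⟩
      filter_upwards [nhdsGT_le_nhdsNE t₀ h] with t ht
      exact mul_inv_cancel₀ ht

noncomputable instance instFieldMeroGerm : Field (meroGerm t₀) := (isField_meroGerm t₀).toField

lemma const_mem_meroGerm (z : ℂ) : ((fun _ => z : ℝ → ℂ) : Germ (𝓝[>] t₀) ℂ) ∈ meroGerm t₀ :=
  ⟨_, .const _ _, rfl⟩

instance instCharZeroMeroGerm : CharZero (meroGerm t₀) where
  cast_injective m n h := by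
    have h' : ((m : meroGerm t₀) : Germ (𝓝[>] t₀) ℂ) = (n : meroGerm t₀) := congrArg Subtype.val h
    rw [Subring.coe_natCast, Subring.coe_natCast, ← Germ.const_nat, ← Germ.const_nat,
      Germ.const_inj] at h'
    exact_mod_cast h'

variable {t₀}

lemma aeval_mem_contGerm {w : Germ (𝓝[>] t₀) ℂ} (hw : w ∈ contGerm t₀) (P : (meroGerm t₀)[X]) :
    aeval w P ∈ contGerm t₀ := by
  rw [aeval_eq_sum_range]
  refine sum_mem fun k _ => ?_
  rw [Algebra.smul_def]
  exact mul_mem (meroGerm_le_contGerm t₀ (P.coeff k).2) (pow_mem hw k)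

lemma eventually_nhdsGT_iff {p : ℝ → Prop} :
    (∀ᶠ t in 𝓝[>] t₀, p t) ↔ ∃ b > t₀, ∀ t ∈ Ioo t₀ b, p t :=
  mem_nhdsGT_iff_exists_Ioo_subset

lemma eventually_continuousAt_of_mem_contGerm {f : ℝ → ℂ}
    (hf : (f : Germ (𝓝[>] t₀) ℂ) ∈ contGerm t₀) : ∀ᶠ t in 𝓝[>] t₀, ContinuousAt f t := by
  obtain ⟨g, hg, e⟩ := hf
  obtain ⟨b, hb, h⟩ := eventually_nhdsGT_iff.1 (hg.and (Germ.coe_eq.1 e))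
  refine eventually_nhdsGT_iff.2 ⟨b, hb, fun t ht => (h t ht).1.congr ?_⟩
  filter_upwards [Ioo_mem_nhds ht.1 ht.2] with s hs using (h s hs).2

lemma eq_zero_or_eq_one_of_mul_self {e : Germ (𝓝[>] t₀) ℂ} (he : e ∈ contGerm t₀)
    (hee : e * e = e) : e = 0 ∨ e = 1 := by
  obtain ⟨f, hf, rfl⟩ := he
  rw [← Germ.coe_mul, Germ.coe_eq] at hee
  obtain ⟨b, hb, h⟩ := eventually_nhdsGT_iff.1 (hf.and hee)
  have hT : ∀ t ∈ Ioo t₀ b, f t ∈ ({0, 1} : Set ℂ) := by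
    intro t ht
    have : f t * f t = f t := (h t ht).2
    have : f t * (f t - 1) = 0 := by linear_combination this
    rcases mul_eq_zero.1 this with h | h
    · simp [h]
    · simp [sub_eq_zero.1 h]
  obtain ⟨c, hc⟩ := nonempty_Ioo.2 hb
  have hconst : ∀ t ∈ Ioo t₀ b, f t = f c := fun t ht =>
    isPreconnected_Ioo.constant_of_mapsTo (Set.toFinite _).isDiscrete
      (fun s hs => (h s hs).1.continuousWithinAt) hT ht hc
  rcases hT c hc with h0 | h1
  · left
    exact Germ.coe_eq.2 (eventually_nhdsGT_iff.2 ⟨b, hb, fun t ht => (hconst t ht).trans h0⟩)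
  · right
    exact Germ.coe_eq.2 (eventually_nhdsGT_iff.2 ⟨b, hb, fun t ht => (hconst t ht).trans h1⟩)

lemma eventually_eq_zero_or_ne_zero {f : ℝ → ℂ} (hf : (f : Germ (𝓝[>] t₀) ℂ) ∈ contGerm t₀)
    (hint : IsIntegral (meroGerm t₀) (f : Germ (𝓝[>] t₀) ℂ)) :
    (∀ᶠ t in 𝓝[>] t₀, f t = 0) ∨ ∀ᶠ t in 𝓝[>] t₀, f t ≠ 0 := by
  obtain ⟨P, hP⟩ := exists_mul_mul_aeval_eq hint
  have hmem := mul_mem hf (aeval_mem_contGerm hf P)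
  generalize aeval (f : Germ (𝓝[>] t₀) ℂ) P = v at hP hmem
  rcases eq_zero_or_eq_one_of_mul_self hmem (by linear_combination v * hP) with h | h
  · left
    rw [h, mul_zero] at hP
    exact Germ.coe_eq.1 hP.symm
  · right
    induction v using Germ.inductionOn with
    | _ v =>
    filter_upwards [Germ.coe_eq.1 h] with t ht h0
    simp [h0] at ht

/-- A right germ that is integral over the meromorphic germs is differentiable, and its
derivative is again integral. -/
lemma deriv_integral {y : ℝ → ℂ} (hy : (y : Germ (𝓝[>] t₀) ℂ) ∈ contGerm t₀)
    (hint : IsIntegral (meroGerm t₀) (y : Germ (𝓝[>] t₀) ℂ)) :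
    (∀ᶠ t in 𝓝[>] t₀, DifferentiableAt ℝ y t) ∧
      ((deriv y : ℝ → ℂ) : Germ (𝓝[>] t₀) ℂ) ∈ contGerm t₀ ∧
      IsIntegral (meroGerm t₀) ((deriv y : ℝ → ℂ) : Germ (𝓝[>] t₀) ℂ) := by
  have hsep : (minpoly (meroGerm t₀) (y : Germ (𝓝[>] t₀) ℂ)).Separable :=
    PerfectField.separable_iff_squarefree.2
      ((minpoly.isRadical _ _).squarefree (minpoly.ne_zero hint))
  have hroot := minpoly.aeval (meroGerm t₀) (y : Germ (𝓝[>] t₀) ℂ)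
  set Q := minpoly (meroGerm t₀) (y : Germ (𝓝[>] t₀) ℂ)
  obtain ⟨A, B, hAB⟩ := hsep
  have hunit : aeval (y : Germ (𝓝[>] t₀) ℂ) B * aeval (y : Germ (𝓝[>] t₀) ℂ) (derivative Q) = 1 := by
    have := congrArg (aeval (y : Germ (𝓝[>] t₀) ℂ)) hAB
    simpa [hroot] using this
  have hrep : ∀ k, ∃ f : ℝ → ℂ, MeromorphicAt f t₀ ∧ (f : Germ (𝓝[>] t₀) ℂ) = Q.coeff k :=
    fun k => (Q.coeff k).2
  choose a ham hae using hrep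
  set N := Q.natDegree + 1
  have hcoe : ∀ (s : Finset ℕ) (F : ℕ → ℝ → ℂ),
      ((fun t => ∑ k ∈ s, F k t : ℝ → ℂ) : Germ (𝓝[>] t₀) ℂ) =
        ∑ k ∈ s, ((F k : ℝ → ℂ) : Germ (𝓝[>] t₀) ℂ) := by
    intro s F
    have := map_sum (Germ.coeRingHom (R := ℂ) (𝓝[>] t₀)) F s
    simp only [Germ.coe_coeRingHom] at this
    rw [← this]
    congr 1
    ext t
    simp
  have e₁ : ((fun t => ∑ k ∈ Finset.range N, a k t * y t ^ k : ℝ → ℂ) : Germ (𝓝[>] t₀) ℂ) = 0 := by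
    rw [hcoe, ← hroot, aeval_eq_sum_range]
    refine Finset.sum_congr rfl fun k _ => ?_
    rw [Algebra.smul_def]
    change _ = (Q.coeff k : Germ (𝓝[>] t₀) ℂ) * _
    rw [← hae]
    rfl
  have e₂ : ((fun t => ∑ k ∈ Finset.range N, a k t * (k * y t ^ (k - 1)) : ℝ → ℂ) :
      Germ (𝓝[>] t₀) ℂ) = aeval (y : Germ (𝓝[>] t₀) ℂ) (derivative Q) := by
    rw [hcoe, derivative_apply, sum_over_range' _ (by simp) N (Nat.lt_succ_self _), map_sum]
    refine Finset.sum_congr rfl fun k _ => ?_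
    simp only [map_mul, aeval_C, map_natCast, map_pow, aeval_X]
    change _ = (Q.coeff k : Germ (𝓝[>] t₀) ℂ) * _ * _
    rw [← hae, mul_assoc]
    rfl
  set QD : (meroGerm t₀)[X] := ∑ k ∈ Finset.range N,
    C (⟨_, deriv (a k), (ham k).deriv, rfl⟩ : meroGerm t₀) * X ^ k with hQD
  have e₃ : ((fun t => ∑ k ∈ Finset.range N, deriv (a k) t * y t ^ k : ℝ → ℂ) :
      Germ (𝓝[>] t₀) ℂ) = aeval (y : Germ (𝓝[>] t₀) ℂ) QD := by
    rw [hcoe, hQD, map_sum]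
    refine Finset.sum_congr rfl fun k _ => ?_
    simp only [map_mul, aeval_C, map_pow, aeval_X]
    rfl
  have hdiff : ∀ᶠ t in 𝓝[>] t₀, ∀ k ∈ Finset.range N, DifferentiableAt ℝ (a k) t := by
    rw [Finset.eventually_all]
    intro k _
    exact nhdsGT_le_nhdsNE t₀ ((ham k).eventually_analyticAt.mono fun t ht => ht.differentiableAt)
  have hne : ∀ᶠ t in 𝓝[>] t₀, ∑ k ∈ Finset.range N, a k t * (k * y t ^ (k - 1)) ≠ 0 := by
    rw [← e₂] at hunit
    generalize aeval (y : Germ (𝓝[>] t₀) ℂ) B = v at hunit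
    induction v using Germ.inductionOn with
    | _ v =>
    filter_upwards [Germ.coe_eq.1 hunit] with t ht h0
    simp [h0] at ht
  have hmain : ∀ᶠ t in 𝓝[>] t₀, HasDerivAt y (-(∑ k ∈ Finset.range N, deriv (a k) t * y t ^ k) /
      ∑ k ∈ Finset.range N, a k t * (k * y t ^ (k - 1))) t := by
    obtain ⟨b, hb, h⟩ := eventually_nhdsGT_iff.1 ((hdiff.and hne).and
      ((eventually_continuousAt_of_mem_contGerm hy).and (Germ.coe_eq.1 e₁)))
    refine eventually_nhdsGT_iff.2 ⟨b, hb, fun t ht => ?_⟩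
    obtain ⟨⟨h₁, h₂⟩, h₃, -⟩ := h t ht
    refine hasDerivAt_of_root h₁ h₃ ?_ h₂
    filter_upwards [Ioo_mem_nhds ht.1 ht.2] with s hs using (h s hs).2.2
  have hgerm : ((deriv y : ℝ → ℂ) : Germ (𝓝[>] t₀) ℂ) =
      aeval (y : Germ (𝓝[>] t₀) ℂ) (-QD * B) := by
    have h₁ : ((deriv y : ℝ → ℂ) : Germ (𝓝[>] t₀) ℂ) *
        aeval (y : Germ (𝓝[>] t₀) ℂ) (derivative Q) = -aeval (y : Germ (𝓝[>] t₀) ℂ) QD := by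
      rw [← e₂, ← e₃]
      refine Germ.coe_eq.2 ?_
      filter_upwards [hmain, hne] with t ht h0
      simp only [ht.deriv]
      exact div_mul_cancel₀ _ h0
    rw [map_mul, map_neg, ← h₁]
    linear_combination (-((deriv y : ℝ → ℂ) : Germ (𝓝[>] t₀) ℂ)) * hunit
  refine ⟨hmain.mono fun t ht => ht.differentiableAt, ?_, ?_⟩
  · rw [hgerm]
    exact aeval_mem_contGerm hy _
  · rw [hgerm]
    rw [aeval_eq_sum_range]
    exact sum_mem (S := integralClosure (meroGerm t₀) (Germ (𝓝[>] t₀) ℂ)) fun k _ =>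
      Subalgebra.smul_mem _ (pow_mem (S := integralClosure _ _) hint k) _

/-- Complex conjugation of germs. -/
def conjGerm {α : Type*} (l : Filter α) : Germ l ℂ →+* Germ l ℂ where
  toFun := Germ.map (starRingEnd ℂ)
  map_one' := by rw [← Germ.coe_one, Germ.map_coe]; congr 1; ext; simp
  map_zero' := by rw [← Germ.coe_zero, Germ.map_coe]; congr 1; ext; simp
  map_mul' φ χ := by
    induction φ, χ using Germ.inductionOn₂ with
    | _ f g =>
    simp only [← Germ.coe_mul, Germ.map_coe]; congr 1; ext; simp
  map_add' φ χ := by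
    induction φ, χ using Germ.inductionOn₂ with
    | _ f g =>
    simp only [← Germ.coe_add, Germ.map_coe]; congr 1; ext; simp

lemma conjGerm_mem_meroGerm {φ : Germ (𝓝[>] t₀) ℂ} (hφ : φ ∈ meroGerm t₀) :
    conjGerm _ φ ∈ meroGerm t₀ := by
  obtain ⟨f, ⟨n, hf⟩, rfl⟩ := hφ
  refine ⟨fun t => starRingEnd ℂ (f t), ⟨n, ?_⟩, rfl⟩
  have h : AnalyticAt ℝ (Complex.conjCLE ∘ fun z => (z - t₀) ^ n • f z) t₀ :=
    (ContinuousLinearMap.analyticAt (Complex.conjCLE : ℂ →L[ℝ] ℂ) _).comp hf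
  refine h.congr (.of_forall fun t => ?_)
  simp

lemma isIntegral_conjGerm {φ : Germ (𝓝[>] t₀) ℂ} (hφ : IsIntegral (meroGerm t₀) φ) :
    IsIntegral (meroGerm t₀) (conjGerm _ φ) :=
  hφ.map_of_comp_eq
    ((conjGerm _).restrict (meroGerm t₀) (meroGerm t₀) fun _ => conjGerm_mem_meroGerm)
    (conjGerm _) rfl

lemma eventually_re_eq_zero_or_ne_zero {f : ℝ → ℂ}
    (hf : (f : Germ (𝓝[>] t₀) ℂ) ∈ contGerm t₀)
    (hint : IsIntegral (meroGerm t₀) (f : Germ (𝓝[>] t₀) ℂ)) :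
    (∀ᶠ t in 𝓝[>] t₀, (f t).re = 0) ∨ ∀ᶠ t in 𝓝[>] t₀, (f t).re ≠ 0 := by
  have hg : ((fun t => ((f t).re : ℂ) : ℝ → ℂ) : Germ (𝓝[>] t₀) ℂ) ∈ contGerm t₀ := by
    refine ⟨_, ?_, rfl⟩
    filter_upwards [eventually_continuousAt_of_mem_contGerm hf] with t ht
    exact (Complex.continuous_ofReal.comp Complex.continuous_re).continuousAt.comp ht
  have hhalf := isIntegral_algebraMap (R := meroGerm t₀) (A := Germ (𝓝[>] t₀) ℂ)
    (x := ⟨_, const_mem_meroGerm t₀ (1 / 2)⟩)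
  have hg' : IsIntegral (meroGerm t₀)
      ((fun t => ((f t).re : ℂ) : ℝ → ℂ) : Germ (𝓝[>] t₀) ℂ) := by
    have e : ((fun t => ((f t).re : ℂ) : ℝ → ℂ) : Germ (𝓝[>] t₀) ℂ) =
        ((fun _ => 1 / 2 : ℝ → ℂ) : Germ (𝓝[>] t₀) ℂ) *
          ((f : Germ (𝓝[>] t₀) ℂ) + conjGerm _ (f : Germ (𝓝[>] t₀) ℂ)) := by
      refine Germ.coe_eq.2 (.of_forall fun t => ?_)
      simp [Complex.re_eq_add_conj]
      ring
    rw [e]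
    exact hhalf.mul (hint.add (isIntegral_conjGerm hint))
  refine (eventually_eq_zero_or_ne_zero hg hg').imp ?_ ?_ <;>
    exact fun h => h.mono fun t ht => by simpa using ht

lemma exists_integrableOn_deriv_right {y : ℝ → ℂ} {N : ℕ} {a : ℕ → ℝ → ℂ}
    (hy : ∀ᶠ t in 𝓝 t₀, ContinuousAt y t) (ha : ∀ k, AnalyticAt ℝ (a k) t₀)
    (hroot : ∀ᶠ t in 𝓝 t₀, y t ^ N + ∑ k ∈ Finset.range N, a k t * y t ^ k = 0) :
    ∃ b > t₀, (∀ t ∈ Ioo t₀ b, DifferentiableAt ℝ y t) ∧ IntegrableOn (deriv y) (Ioo t₀ b) := by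
  have hcont : (y : Germ (𝓝[>] t₀) ℂ) ∈ contGerm t₀ := ⟨y, nhdsWithin_le_nhds hy, rfl⟩
  have hint : IsIntegral (meroGerm t₀) (y : Germ (𝓝[>] t₀) ℂ) := by
    let c : ℕ → meroGerm t₀ := fun k => ⟨_, a k, (ha k).meromorphicAt, rfl⟩
    refine ⟨X ^ N + ∑ k ∈ Finset.range N, C (c k) * X ^ k, ?_, ?_⟩
    · refine monic_X_pow_add ?_
      refine mem_degreeLT.1 (sum_mem fun k hk => mem_degreeLT.2 ?_)
      refine (degree_C_mul_X_pow_le k _).trans_lt ?_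
      exact_mod_cast Finset.mem_range.1 hk
    · rw [← aeval_def]
      simp only [map_add, map_pow, aeval_X, map_sum, map_mul, aeval_C]
      have h : ∀ k, algebraMap (meroGerm t₀) (Germ (𝓝[>] t₀) ℂ) (c k) =
        Germ.coeRingHom (𝓝[>] t₀) (a k) := fun k => rfl
      have h' : (y : Germ (𝓝[>] t₀) ℂ) = Germ.coeRingHom (𝓝[>] t₀) y := rfl
      simp only [h, h', ← map_pow, ← map_mul, ← map_sum, ← map_add]
      refine Germ.coe_eq.2 ?_
      filter_upwards [nhdsWithin_le_nhds hroot] with t ht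
      simpa using ht
  obtain ⟨hdiff, hdc, hdi⟩ := deriv_integral hcont hint
  have hIdi : IsIntegral (meroGerm t₀)
      ((fun t => -Complex.I * deriv y t : ℝ → ℂ) : Germ (𝓝[>] t₀) ℂ) :=
    (isIntegral_algebraMap (R := meroGerm t₀) (A := Germ (𝓝[>] t₀) ℂ)
      (x := ⟨_, const_mem_meroGerm t₀ (-Complex.I)⟩)).mul hdi
  have hIdc : ((fun t => -Complex.I * deriv y t : ℝ → ℂ) : Germ (𝓝[>] t₀) ℂ) ∈ contGerm t₀ :=
    mul_mem (meroGerm_le_contGerm t₀ (const_mem_meroGerm t₀ (-Complex.I))) hdc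
  have hre := eventually_re_eq_zero_or_ne_zero hdc hdi
  have him := eventually_re_eq_zero_or_ne_zero hIdc hIdi
  have hall : ∃ b > t₀, (∀ t ∈ Ioo t₀ b, DifferentiableAt ℝ y t) ∧
      ContinuousOn y (Icc t₀ b) ∧
      ((∀ t ∈ Ioo t₀ b, (deriv y t).re = 0) ∨ ∀ t ∈ Ioo t₀ b, (deriv y t).re ≠ 0) ∧
      ((∀ t ∈ Ioo t₀ b, (deriv y t).im = 0) ∨ ∀ t ∈ Ioo t₀ b, (deriv y t).im ≠ 0) := by
    simp only [neg_mul, Complex.neg_re, Complex.I_mul_re, neg_neg] at him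
    obtain ⟨ε, hε, hball⟩ := Metric.eventually_nhds_iff_ball.1 hy
    have hlt : ∀ᶠ t in 𝓝[>] t₀, t < t₀ + ε / 2 :=
      nhdsWithin_le_nhds (eventually_lt_nhds (by linarith))
    have conv : ∀ {p : ℝ → Prop} {q : ℝ → Prop}, ((∀ᶠ t in 𝓝[>] t₀, p t) ∨ ∀ᶠ t in 𝓝[>] t₀, q t) →
        ∃ b > t₀, (∀ t ∈ Ioo t₀ b, p t) ∨ ∀ t ∈ Ioo t₀ b, q t := by
      rintro p q (h | h)
      · obtain ⟨b, hb, h⟩ := eventually_nhdsGT_iff.1 h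
        exact ⟨b, hb, .inl h⟩
      · obtain ⟨b, hb, h⟩ := eventually_nhdsGT_iff.1 h
        exact ⟨b, hb, .inr h⟩
    obtain ⟨b₁, hb₁, h₁⟩ := conv hre
    obtain ⟨b₂, hb₂, h₂⟩ := conv him
    obtain ⟨b₃, hb₃, h₃⟩ := eventually_nhdsGT_iff.1 hdiff
    have hb : t₀ < min (min b₁ b₂) (min b₃ (t₀ + ε / 2)) := by
      simp only [lt_min_iff]
      exact ⟨⟨hb₁, hb₂⟩, hb₃, by linarith⟩
    have i₁ : ∀ t ∈ Ioo t₀ (min (min b₁ b₂) (min b₃ (t₀ + ε / 2))), t ∈ Ioo t₀ b₁ :=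
      fun t ht => ⟨ht.1, (lt_min_iff.1 (lt_min_iff.1 ht.2).1).1⟩
    have i₂ : ∀ t ∈ Ioo t₀ (min (min b₁ b₂) (min b₃ (t₀ + ε / 2))), t ∈ Ioo t₀ b₂ :=
      fun t ht => ⟨ht.1, (lt_min_iff.1 (lt_min_iff.1 ht.2).1).2⟩
    have i₃ : ∀ t ∈ Ioo t₀ (min (min b₁ b₂) (min b₃ (t₀ + ε / 2))), t ∈ Ioo t₀ b₃ :=
      fun t ht => ⟨ht.1, (lt_min_iff.1 (lt_min_iff.1 ht.2).2).1⟩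
    refine ⟨_, hb, fun t ht => h₃ t (i₃ t ht), fun t ht => (hball t ?_).continuousWithinAt,
      h₁.imp (fun h t ht => h t (i₁ t ht)) (fun h t ht => h t (i₁ t ht)),
      h₂.imp (fun h t ht => h t (i₂ t ht)) (fun h t ht => h t (i₂ t ht))⟩
    have : t ≤ t₀ + ε / 2 := ht.2.trans ((min_le_right _ _).trans (min_le_right _ _))
    rw [Real.ball_eq_Ioo]
    exact ⟨by linarith [ht.1], by linarith⟩
  obtain ⟨b, hb, hd, hc, h₁, h₂⟩ := hall
  refine ⟨b, hb, hd, ?_⟩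
  have e₁ := integrableOn_of_hasDerivAt_of_ne (Complex.continuous_re.comp_continuousOn hc)
    (fun t ht => (Complex.reCLM.hasFDerivAt.comp_hasDerivAt t (hd t ht).hasDerivAt)) h₁
  have e₂ := integrableOn_of_hasDerivAt_of_ne (Complex.continuous_im.comp_continuousOn hc)
    (fun t ht => (Complex.imCLM.hasFDerivAt.comp_hasDerivAt t (hd t ht).hasDerivAt)) h₂
  refine (e₁.ofReal.add (e₂.ofReal.mul_const Complex.I)).congr (.of_forall fun t => ?_)
  exact Complex.re_add_im _

lemma exists_integrableOn_deriv {y : ℝ → ℂ} {N : ℕ} {a : ℕ → ℝ → ℂ}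
    (hy : ∀ᶠ t in 𝓝 t₀, ContinuousAt y t) (ha : ∀ k, AnalyticAt ℝ (a k) t₀)
    (hroot : ∀ᶠ t in 𝓝 t₀, y t ^ N + ∑ k ∈ Finset.range N, a k t * y t ^ k = 0) :
    ∃ U ∈ 𝓝 t₀, (∀ t ∈ U, t ≠ t₀ → DifferentiableAt ℝ y t) ∧ IntegrableOn (deriv y) U := by
  obtain ⟨b, hb, hd, hi⟩ := exists_integrableOn_deriv_right hy ha hroot
  have hneg : Tendsto (fun t : ℝ => -t) (𝓝 (-t₀)) (𝓝 t₀) := by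
    simpa using (continuous_neg.tendsto (-t₀))
  obtain ⟨c, hc, hd', hi'⟩ := exists_integrableOn_deriv_right (t₀ := -t₀)
    (y := fun t => y (-t)) (N := N) (a := fun k t => a k (-t))
    ((hneg.eventually hy).mono fun t ht => ht.comp (f := fun t : ℝ => -t)
      continuous_neg.continuousAt)
    (fun k => AnalyticAt.fun_comp (by simpa using ha k) analyticAt_id.neg)
    (hneg.eventually hroot)
  refine ⟨Ioo (-c) b, Ioo_mem_nhds (by linarith) hb, fun t ht hne => ?_, ?_⟩
  · rcases lt_or_gt_of_ne hne with h | h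
    · have := hd' (-t) ⟨by linarith, by linarith [ht.1]⟩
      have h2 : DifferentiableAt ℝ (fun s : ℝ => y (- -s)) t :=
        this.comp (f := fun s : ℝ => -s) t differentiable_neg.differentiableAt
      simpa using h2
    · exact hd t ⟨h, ht.2⟩
  · have h₁ : IntegrableOn (deriv y) (Ioo (-c) t₀) := by
      have h₂ : IntegrableOn (fun s => -deriv (fun t => y (-t)) (-s)) (Ioo (-c) t₀) := by
        have := ((Measure.measurePreserving_neg (volume : Measure ℝ)).integrableOn_comp_preimage
          (Homeomorph.neg ℝ).measurableEmbedding).2 hi'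
        simpa [Function.comp_def] using this.neg
      refine h₂.congr_fun (fun s _ => ?_) measurableSet_Ioo
      simp [deriv_comp_neg]
    have hsub : Ioo (-c) b ⊆ (Ioo (-c) t₀ ∪ Ioo t₀ b) ∪ {t₀} := by
      intro t ht
      rcases lt_trichotomy t t₀ with h | h | h
      · exact .inl (.inl ⟨ht.1, h⟩)
      · exact .inr h
      · exact .inl (.inr ⟨h, ht.2⟩)
    exact ((h₁.union hi).union (by simp)).mono_set hsub

/-- A continuous root of a monic polynomial with real-analytic coefficients is locally
absolutely continuous. -/
theorem integrableOn_deriv_and_eq_integral {y : ℝ → ℂ} {N : ℕ} {a : ℕ → ℝ → ℂ} {I : Set ℝ}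
    (hI : IsOpen I) (hy : ContinuousOn y I) (ha : ∀ k, AnalyticOnNhd ℝ (a k) I)
    (hroot : ∀ t ∈ I, y t ^ N + ∑ k ∈ Finset.range N, a k t * y t ^ k = 0) {b c : ℝ}
    (hsub : Icc b c ⊆ I) : IntegrableOn (deriv y) (Icc b c) ∧
      ∀ t ∈ Icc b c, y t = y b + ∫ s in b..t, deriv y s := by
  have hloc : ∀ t ∈ Icc b c, ∃ U ∈ 𝓝 t, (∀ s ∈ U, s ≠ t → DifferentiableAt ℝ y s) ∧
      IntegrableOn (deriv y) U := by
    intro t ht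
    have hIt := hI.mem_nhds (hsub ht)
    refine exists_integrableOn_deriv (N := N) (a := a) ?_ (fun k => ha k t (hsub ht)) ?_
    · filter_upwards [hIt] with s hs using hy.continuousAt (hI.mem_nhds hs)
    · filter_upwards [hIt] with s hs using hroot s hs
  have hint : IntegrableOn (deriv y) (Icc b c) := by
    refine LocallyIntegrableOn.integrableOn_isCompact (fun t ht => ?_) isCompact_Icc
    obtain ⟨U, hU, -, h⟩ := hloc t ht
    exact ⟨U, mem_nhdsWithin_of_mem_nhds hU, h⟩
  refine ⟨hint, fun t ht => ?_⟩
  choose! U hU hUd _ using hloc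
  obtain ⟨F, hFm, hF⟩ := isCompact_Icc.elim_nhds_subcover U hU
  have hF' : ∀ s ∈ Icc b c, s ∉ F → DifferentiableAt ℝ y s := by
    intro s hs hsF
    obtain ⟨x, hx, hxs⟩ := mem_iUnion₂.1 (hF hs)
    exact hUd x (hFm x hx) s hxs fun h => hsF (h ▸ hx)
  have hbt : Icc b t ⊆ Icc b c := Icc_subset_Icc_right ht.2
  have := integral_eq_of_hasDerivAt_off_countable_of_le y (deriv y) ht.1 F.countable_toSet
    (hy.mono (hbt.trans hsub))
    (fun s hs => (hF' s (hbt (Ioo_subset_Icc_self hs.1)) hs.2).hasDerivAt)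
    ((intervalIntegrable_iff_integrableOn_Icc_of_le ht.1).2 (hint.mono_set hbt))
  rw [this]
  ring

end AlgebraicGerm

namespace InvariantMap

open MvPolynomial

section Algebra

lemma eval_aeval_eq {ι κ K : Type*} [CommSemiring K] (σ : κ → MvPolynomial ι K)
    (p : MvPolynomial κ K) (x : ι → K) :
    eval x (aeval σ p) = eval (fun k => eval x (σ k)) p := by
  rw [aeval_eq_bind₁]
  exact eval₂Hom_bind₁ (RingHom.id K) x σ p

variable {ι κ K G : Type*} [Fintype ι] [Field K] [Group G]
  (ρ : G →* ((ι → K) ≃ₗ[K] (ι → K)))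

/-- The `j`-th coordinate of the action of `g`, as a linear form. -/
noncomputable def coordForm (g : G) (j : ι) : MvPolynomial ι K := by
  classical exact ∑ i, C (ρ g (Pi.single i 1) j) * X i

lemma eval_coordForm (g : G) (j : ι) (x : ι → K) : eval x (coordForm ρ g j) = ρ g x j := by
  classical
  conv_rhs => rw [pi_eq_sum_univ' x]
  simp [coordForm, mul_comm]

lemma eval_bind₁_coordForm (g : G) (f : MvPolynomial ι K) (x : ι → K) :
    eval x (bind₁ (coordForm ρ g) f) = eval (ρ g x) f := by
  have := eval₂Hom_bind₁ (RingHom.id K) x (coordForm ρ g) f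
  have h : (fun i => (eval₂Hom (RingHom.id K) x) (coordForm ρ g i)) = ρ g x :=
    funext fun j => eval_coordForm ρ g j x
  rw [h] at this
  exact this

variable [Fintype G] {ρ} {σ : κ → MvPolynomial ι K}

lemma exists_monic_relation
    (hgen : ∀ f : MvPolynomial ι K, (∀ g x, eval (ρ g x) f = eval x f) →
      ∃ p : MvPolynomial κ K, aeval σ p = f)
    (j : ι) : ∃ p : ℕ → MvPolynomial κ K, ∀ x : ι → K,
    x j ^ Fintype.card G +
      ∑ k ∈ Finset.range (Fintype.card G), eval (fun i => eval x (σ i)) (p k) * x j ^ k = 0 := by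
  let P : Polynomial (MvPolynomial ι K) :=
    ∏ g : G, (Polynomial.X - Polynomial.C (coordForm ρ g j))
  have hmap : ∀ x : ι → K, P.map (eval x) =
      ∏ g : G, (Polynomial.X - Polynomial.C (ρ g x j)) := by
    intro x
    simp [P, Polynomial.map_prod, eval_coordForm]
  have hdeg : P.natDegree = Fintype.card G := by
    simp [P, Polynomial.natDegree_finsetProd_X_sub_C_eq_card]
  have hmonic : P.Monic := Polynomial.monic_prod_of_monic _ _ fun g _ => Polynomial.monic_X_sub_C _
  have hcoeff : ∀ k, ∃ p : MvPolynomial κ K, aeval σ p = P.coeff k := by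
    refine fun k => hgen _ fun h x => ?_
    rw [← Polynomial.coeff_map, ← Polynomial.coeff_map, hmap, hmap]
    congr 1
    refine Fintype.prod_equiv (Equiv.mulRight h) _ _ fun g => ?_
    simp [LinearEquiv.mul_apply]
  choose p hp using hcoeff
  refine ⟨p, fun x => ?_⟩
  have hzero : (P.map (eval x)).eval (x j) = 0 := by
    rw [hmap, Polynomial.eval_prod]
    exact Finset.prod_eq_zero (Finset.mem_univ 1) (by simp)
  rw [hmonic.as_sum, hdeg] at hzero
  simpa only [Polynomial.map_add, Polynomial.map_sum, Polynomial.map_pow, Polynomial.map_mul,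
    Polynomial.map_X, Polynomial.map_C, Polynomial.eval_add, Polynomial.eval_finsetSum,
    Polynomial.eval_pow, Polynomial.eval_mul, Polynomial.eval_X, Polynomial.eval_C, ← hp,
    eval_aeval_eq] using hzero

lemma exists_smul_eq_of_forall_eval_eq
    (hgen : ∀ f : MvPolynomial ι K, (∀ g x, eval (ρ g x) f = eval x f) →
      ∃ p : MvPolynomial κ K, aeval σ p = f)
    [CharZero K] {x y : ι → K}
    (hxy : ∀ k, eval x (σ k) = eval y (σ k)) : ∃ g, ρ g x = y := by
  classical
  by_contra! hne
  let S : Finset (ι → K) :=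
    (Finset.univ.image (fun g => ρ g x) ∪ Finset.univ.image (fun g => ρ g y)).erase x
  have hS : ∀ z : S, ∃ j, x j ≠ z.1 j := fun z =>
    Function.ne_iff.1 (Finset.ne_of_mem_erase z.2).symm
  choose j hj using hS
  let f : MvPolynomial ι K := ∏ z : S, (X (j z) - C (z.1 (j z)))
  have hf : ∀ z ∈ S, eval z f = 0 := by
    intro z hz
    rw [map_prod]
    exact Finset.prod_eq_zero (Finset.mem_univ ⟨z, hz⟩) (by simp)
  have hfx : eval x f ≠ 0 := by
    rw [map_prod]
    exact Finset.prod_ne_zero_iff.2 fun z _ => by simpa [sub_eq_zero] using hj z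
  let F : MvPolynomial ι K := ∑ g : G, bind₁ (coordForm ρ g) f
  have hF : ∀ z, eval z F = ∑ g : G, eval (ρ g z) f := by
    intro z
    simp [F, eval_bind₁_coordForm]
  obtain ⟨p, hp⟩ := hgen F fun h z => by
    rw [hF, hF]
    refine Fintype.sum_equiv (Equiv.mulRight h) _ _ fun g => ?_
    simp [LinearEquiv.mul_apply]
  have hFxy : eval x F = eval y F := by
    rw [← hp, eval_aeval_eq, eval_aeval_eq]
    simp [hxy]
  have hFy : eval y F = 0 := by
    rw [hF]
    refine Finset.sum_eq_zero fun g _ => hf _ (Finset.mem_erase.2 ⟨fun e => ?_, by simp⟩)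
    refine hne g⁻¹ ?_
    rw [← e, ← LinearEquiv.mul_apply, ← map_mul]
    simp
  have hFx : eval x F = (Finset.univ.filter fun g => ρ g x = x).card • eval x f := by
    rw [hF, ← Finset.sum_const, Finset.sum_filter]
    refine Finset.sum_congr rfl fun g _ => ?_
    split_ifs with h
    · rw [h]
    · exact hf _ (Finset.mem_erase.2 ⟨h, by simp⟩)
  rw [hFxy, hFy, nsmul_eq_mul] at hFx
  have hcard : ((Finset.univ.filter fun g => ρ g x = x).card : K) ≠ 0 := by
    exact_mod_cast Finset.card_ne_zero_of_mem (a := 1) (by simp)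
  exact mul_ne_zero hcard hfx hFx.symm

end Algebra

section Topology

lemma norm_le_of_monic_relation {z : ℂ} {N : ℕ} {a : ℕ → ℂ} {M : ℝ}
    (hM : ∀ k ∈ Finset.range N, ‖a k‖ ≤ M)
    (hz : z ^ N + ∑ k ∈ Finset.range N, a k * z ^ k = 0) : ‖z‖ ≤ max 1 (N * M) := by
  by_contra! h
  obtain ⟨h1, h2⟩ := max_lt_iff.1 h
  obtain _ | N := N
  · simp at hz
  have hle : ‖z‖ ^ (N + 1) ≤ ((N + 1 : ℕ) * M) * ‖z‖ ^ N := by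
    rw [← norm_pow, eq_neg_of_add_eq_zero_left hz, norm_neg]
    refine (norm_sum_le_of_le (n := fun _ => M * ‖z‖ ^ N) _ fun k hk => ?_).trans ?_
    · rw [norm_mul, norm_pow]
      have := Finset.mem_range.1 hk
      exact mul_le_mul (hM k hk) (pow_le_pow_right₀ h1.le (by omega)) (by positivity)
        ((norm_nonneg _).trans (hM k hk))
    · simp [mul_assoc]
  have hpos : 0 < ‖z‖ ^ N := by positivity
  rw [pow_succ', mul_le_mul_iff_left₀ hpos] at hle
  exact absurd hle (not_le.2 h2)

variable {ι κ G : Type*} [Fintype ι] [Fintype κ] [Group G] [Fintype G]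
  {ρ : G →* ((ι → ℂ) ≃ₗ[ℂ] (ι → ℂ))} {σ : κ → MvPolynomial ι ℂ}

lemma exists_forall_norm_le_of_isBounded
    (hgen : ∀ f : MvPolynomial ι ℂ, (∀ g x, eval (ρ g x) f = eval x f) →
      ∃ p : MvPolynomial κ ℂ, aeval σ p = f)
    {B : Set (κ → ℂ)} (hB : Bornology.IsBounded B) :
    ∃ R, ∀ x : ι → ℂ, (fun k => eval x (σ k)) ∈ B → ‖x‖ ≤ R := by
  choose p hp using exists_monic_relation hgen
  have hbound : ∀ q : MvPolynomial κ ℂ, ∃ M : ℝ, ∀ y ∈ B, ‖eval y q‖ ≤ M := by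
    intro q
    obtain ⟨M, hM⟩ := hB.isCompact_closure.exists_bound_of_continuousOn
      (f := fun y => eval y q) (MvPolynomial.continuous_eval q).continuousOn
    exact ⟨M, fun y hy => hM y (subset_closure hy)⟩
  choose M hM using hbound
  have hcoord : ∀ j, ∃ R : ℝ, ∀ x : ι → ℂ, (fun k => eval x (σ k)) ∈ B → ‖x j‖ ≤ R := by
    intro j
    refine ⟨_, fun x hx => norm_le_of_monic_relation
      (M := ∑ k ∈ Finset.range (Fintype.card G), |M (p j k)|) (fun k hk => ?_) (hp j x)⟩
    exact ((hM _ _ hx).trans (le_abs_self _)).trans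
      (Finset.single_le_sum (f := fun k => |M (p j k)|) (fun _ _ => abs_nonneg _) hk)
  choose R hR using hcoord
  refine ⟨∑ j, |R j|, fun x hx => ?_⟩
  refine (pi_norm_le_iff_of_nonneg (Finset.sum_nonneg fun _ _ => abs_nonneg _)).2 fun j => ?_
  exact ((hR j x hx).trans (le_abs_self _)).trans
    (Finset.single_le_sum (f := fun j => |R j|) (fun _ _ => abs_nonneg _) (Finset.mem_univ j))

lemma eventually_exists_mem
    (hgen : ∀ f : MvPolynomial ι ℂ, (∀ g x, eval (ρ g x) f = eval x f) →
      ∃ p : MvPolynomial κ ℂ, aeval σ p = f)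
    {c : ℝ → κ → ℂ} {q : ℝ → ι → ℂ} {t₀ : ℝ}
    (hc : ContinuousAt c t₀) (hq : ∀ᶠ t in 𝓝 t₀, (fun k => eval (q t) (σ k)) = c t)
    {U : Set (ι → ℂ)} (hU : U ∈ 𝓝 (q t₀)) : ∀ᶠ t in 𝓝 t₀, ∃ g, ρ g (q t) ∈ U := by
  obtain ⟨V, hVU, hV, hqV⟩ := mem_nhds_iff.1 hU
  obtain ⟨R, hR⟩ := exists_forall_norm_le_of_isBounded hgen
    (Metric.isBounded_ball (x := c t₀) (r := 1))
  let s : (ι → ℂ) → κ → ℂ := fun x k => eval x (σ k)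
  have hs : Continuous s := continuous_pi fun k => MvPolynomial.continuous_eval (σ k)
  let E : Set (ι → ℂ) := Metric.closedBall 0 R ∩ ⋂ g : G, (ρ g) ⁻¹' Vᶜ
  have hE : IsCompact E := (isCompact_closedBall 0 R).inter_right <| isClosed_iInter fun g =>
    hV.isClosed_compl.preimage (ρ g).toLinearMap.continuous_of_finiteDimensional
  have hmem : c t₀ ∉ s '' E := by
    rintro ⟨x, hx, hxt⟩
    obtain ⟨g, hg⟩ := exists_smul_eq_of_forall_eval_eq hgen (x := x) (y := q t₀)
      fun k => congrFun (hxt.trans hq.self_of_nhds.symm) k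
    exact mem_iInter.1 hx.2 g (by rwa [hg])
  filter_upwards [hq, hc.preimage_mem_nhds ((hE.image hs).isClosed.isOpen_compl.mem_nhds hmem),
    hc.preimage_mem_nhds (Metric.ball_mem_nhds _ one_pos)] with t ht ht₁ ht₂
  by_contra! hne
  refine ht₁ ⟨q t, ⟨?_, mem_iInter.2 fun g hg => hne g (hVU hg)⟩, ht⟩
  exact mem_closedBall_zero_iff.2 (hR _ (by rwa [ht]))

/-- A continuous curve in the image of the invariant map has a continuous lift. -/
theorem exists_continuousOn_lift
    (hgen : ∀ f : MvPolynomial ι ℂ, (∀ g x, eval (ρ g x) f = eval x f) →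
      ∃ p : MvPolynomial κ ℂ, aeval σ p = f)
    (hinv : ∀ k g x, eval (ρ g x) (σ k) = eval x (σ k)) {I : Set ℝ} (hI : IsOpen I)
    {c : ℝ → κ → ℂ} (hc : ContinuousOn c I)
    (hcσ : ∀ t ∈ I, ∃ x : ι → ℂ, (fun k => eval x (σ k)) = c t) :
    ∃ f : ℝ → ι → ℂ, ContinuousOn f I ∧ ∀ t ∈ I, (fun k => eval (f t) (σ k)) = c t := by
  choose! q hq using hcσ
  let _ : MulAction G (ι → ℂ) :=
    { smul := fun g x => ρ g x
      one_smul := fun x => by change ρ 1 x = x; simp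
      mul_smul := fun g h x => by change ρ (g * h) x = ρ g (ρ h x); simp [LinearEquiv.mul_apply] }
  have hsmul : ∀ (g : G) (x : ι → ℂ), g • x = ρ g x := fun _ _ => rfl
  have : ContinuousConstSMul G (ι → ℂ) :=
    ⟨fun g => (ρ g).toLinearMap.continuous_of_finiteDimensional⟩
  obtain ⟨f, hf, hfq⟩ := PathLifting.OrbitContinuousOn.exists_orbitLift (⊤ : Subgroup G) q I hI
    fun t ht U hU => (eventually_exists_mem hgen (hc.continuousAt (hI.mem_nhds ht))
      (by filter_upwards [hI.mem_nhds ht] with s hs using hq s hs) hU).mono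
      fun s ⟨g, hg⟩ => ⟨g, trivial, hg⟩
  refine ⟨f, hf, fun t ht => ?_⟩
  obtain ⟨g, -, hg⟩ := hfq t ht
  rw [← hq t ht, hg, hsmul]
  exact funext fun k => hinv k g (q t)

end Topology

end InvariantMap

/-- A real-analytic curve in `σ(ℂ^m)` admits a continuous lift which is
absolutely continuous on every compact subinterval. -/
theorem stmt5
    {m n : ℕ} {G : Type} [Group G] [Fintype G]
    (ρ : G →* ((Fin m → ℂ) ≃ₗ[ℂ] (Fin m → ℂ)))
    (σ : Fin n → MvPolynomial (Fin m) ℂ) (deg : Fin n → ℕ)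
    (hdeg : ∀ k, 1 ≤ deg k)
    (hhom : ∀ k, (σ k).IsHomogeneous (deg k))
    (hinv : ∀ k g x, MvPolynomial.eval (ρ g x) (σ k) = MvPolynomial.eval x (σ k))
    (hgen : ∀ f : MvPolynomial (Fin m) ℂ,
      (∀ g x, MvPolynomial.eval (ρ g x) f = MvPolynomial.eval x f) →
      ∃ p : MvPolynomial (Fin n) ℂ, MvPolynomial.aeval σ p = f)
    (σm : (Fin m → ℂ) → (Fin n → ℂ))
    (hσm : ∀ x k, σm x k = MvPolynomial.eval x (σ k))
    (I : Set ℝ) (hIo : IsOpen I) (hIc : I.OrdConnected)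
    (c : ℝ → Fin n → ℂ) (hc : AnalyticOnNhd ℝ c I)
    (hcσ : ∀ t ∈ I, ∃ x : Fin m → ℂ, σm x = c t) :
    ∃ cb : ℝ → Fin m → ℂ, ContinuousOn cb I ∧ (∀ t ∈ I, σm (cb t) = c t) ∧
      ∀ a b : ℝ, a ≤ b → Set.Icc a b ⊆ I →
        ∃ g : ℝ → Fin m → ℂ, IntegrableOn g (Set.Icc a b) ∧
          ∀ t ∈ Set.Icc a b, cb t = cb a + ∫ s in a..t, g s := by
  obtain rfl : σm = fun x k => MvPolynomial.eval x (σ k) := funext fun x => funext (hσm x)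
  obtain ⟨cb, hcb, hlift⟩ :=
    InvariantMap.exists_continuousOn_lift hgen hinv hIo hc.continuousOn hcσ
  refine ⟨cb, hcb, hlift, fun a b _ hsub => ?_⟩
  choose p hp using InvariantMap.exists_monic_relation hgen
  have hanalytic : ∀ j k, AnalyticOnNhd ℝ (fun t => MvPolynomial.eval (c t) (p j k)) I :=
    fun j k => AnalyticOnNhd.aeval_mvPolynomial
      (fun i t ht => (ContinuousLinearMap.proj (R := ℝ) (φ := fun _ : Fin n => ℂ) i).analyticAt
        (c t) |>.comp (hc t ht)) (p j k)
  have hcoord := fun j => AlgebraicGerm.integrableOn_deriv_and_eq_integral hIo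
    (continuousOn_pi.1 hcb j) (hanalytic j)
    (fun t ht => by simpa only [← hlift t ht] using hp j (cb t)) hsub
  refine ⟨fun s j => deriv (fun t => cb t j) s, Integrable.of_eval fun j => (hcoord j).1,
    fun t ht => funext fun j => ?_⟩
  rw [Pi.add_apply, intervalIntegral.integral_of_le ht.1, eval_integral,
    ← intervalIntegral.integral_of_le ht.1]
  · exact (hcoord j).2 t ht
  · exact fun j => (hcoord j).1.mono_set
      (Ioc_subset_Icc_self.trans (Icc_subset_Icc_right ht.2))
end
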